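/- arXiv:2310.16599 — 2 statements merged into one kernel-verified Lean document; each statement's English description precedes it below -/
import Mathlib

section
/- Let $(R,\mathfrak{m})$ be a commutative noetherian local ring with $\operatorname{depth} R > 0$. Then the following are equivalent: (1) every finitely generated $R$-module $M$ with $\operatorname{Ext}_R^i(M,R)=0$ for all $i>0$ is totally reflexive; (2) every finitely generated $R$-module $M$ with $\operatorname{Ext}_R^i(M,R)=0$ for all $i>0$ satisfies $\operatorname{depth} M > 0$. -/
open CategoryTheory IsLocalRing

noncomputable section

/-- The `i`-th Ext group of `R`-modules `M`, `N`, as a `ModuleCat R`. -/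
def ExtGroup (R : Type) [CommRing R] (i : ℕ) (M N : ModuleCat.{0} R) : ModuleCat R :=
  ((Ext R (ModuleCat.{0} R) i).obj (Opposite.op M)).obj N

/-- The `i`-th Tor group. -/
def TorGroup (R : Type) [CommRing R] (i : ℕ) (M N : ModuleCat.{0} R) : ModuleCat R :=
  ((Tor (ModuleCat.{0} R) i).obj M).obj N

/-- `Ext_R^i(M, N) = 0` for all `i ≫ 0`. -/
def ExtEventuallyZero (R : Type) [CommRing R] (M N : ModuleCat.{0} R) : Prop :=
  ∃ t : ℕ, ∀ i > t, Subsingleton (ExtGroup R i M N)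

/-- Property (ee). -/
def PropEE (R : Type) [CommRing R] : Prop :=
  ∀ M N : ModuleCat.{0} R, Module.Finite R M → Module.Finite R N →
    ExtEventuallyZero R M N → ExtEventuallyZero R N M

/-- Gorenstein: `Ext^i(k, R) = 0` for `i ≫ 0`. -/
def IsGorensteinLocalRing (R : Type) [CommRing R] [IsLocalRing R] : Prop :=
  ∃ t : ℕ, ∀ i > t, Subsingleton
    (ExtGroup R i (ModuleCat.of R (ResidueField R)) (ModuleCat.of R R))

open Classical in
/-- depth of a module over a local ring, with depth of zero module = ⊤. -/
def rdepth (R : Type) [CommRing R] [IsLocalRing R]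
    (M : Type) [AddCommGroup M] [Module R M] : ℕ∞ :=
  if Subsingleton M then ⊤ else
    sSup {n : ℕ∞ | ∃ rs : List R, (rs.length : ℕ∞) = n ∧
      (∀ r ∈ rs, r ∈ maximalIdeal R) ∧ RingTheory.Sequence.IsRegular M rs}

/-- Totally reflexive module. -/
def IsTotallyReflexive (R : Type) [CommRing R]
    (M : Type) [AddCommGroup M] [Module R M] : Prop :=
  Module.Finite R M ∧ Function.Bijective (Module.Dual.eval R M) ∧
  (∀ i > 0, Subsingleton (ExtGroup R i (ModuleCat.of R M) (ModuleCat.of R R))) ∧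
  (∀ i > 0, Subsingleton
    (ExtGroup R i (ModuleCat.of R (Module.Dual R M)) (ModuleCat.of R R)))

/-- Property (tr). -/
def PropTR (R : Type) [CommRing R] : Prop :=
  ∀ (M : Type) [AddCommGroup M] [Module R M], Module.Finite R M →
    (∀ i > 0, Subsingleton (ExtGroup R i (ModuleCat.of R M) (ModuleCat.of R R))) →
    IsTotallyReflexive R M

/-- Property (dep): the depth formula (written additively to avoid truncated subtraction). -/
def PropDep (R : Type) [CommRing R] [IsLocalRing R] : Prop :=
  ∀ (M N : Type) [AddCommGroup M] [Module R M] [AddCommGroup N] [Module R N],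
    Module.Finite R M → Module.Finite R N → Nontrivial M → Nontrivial N →
    (∀ i > 0, Subsingleton (TorGroup R i (ModuleCat.of R M) (ModuleCat.of R N))) →
    rdepth R (TensorProduct R M N) + rdepth R R = rdepth R M + rdepth R N

/-- AB ring. -/
def IsABRing (R : Type) [CommRing R] [IsLocalRing R] : Prop :=
  IsGorensteinLocalRing R ∧ ∃ n : ℕ, ∀ M N : ModuleCat.{0} R,
    Module.Finite R M → Module.Finite R N → ExtEventuallyZero R M N →
    ∀ i > n, Subsingleton (ExtGroup R i M N)

/-- A complex of finitely generated projective modules, indexed by `ℤ`. -/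
structure FGProjComplex (R : Type) [CommRing R] where
  X : ℤ → Type
  [acg : ∀ n, AddCommGroup (X n)]
  [mod : ∀ n, Module R (X n)]
  [fin : ∀ n, Module.Finite R (X n)]
  [proj : ∀ n, Module.Projective R (X n)]
  d : ∀ n : ℤ, X n →ₗ[R] X (n + 1)
  dd : ∀ n : ℤ, (d (n + 1)).comp (d n) = 0

attribute [instance] FGProjComplex.acg FGProjComplex.mod FGProjComplex.fin FGProjComplex.proj

/-- Acyclicity of such a complex. -/
def FGProjComplex.Acyclic {R : Type} [CommRing R] (C : FGProjComplex R) : Prop :=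
  ∀ n : ℤ, LinearMap.ker (C.d (n + 1)) = LinearMap.range (C.d n)

/-- The dual complex is acyclic. -/
def FGProjComplex.DualAcyclic {R : Type} [CommRing R] (C : FGProjComplex R) : Prop :=
  ∀ n : ℤ, LinearMap.ker ((C.d n).dualMap) = LinearMap.range ((C.d (n + 1)).dualMap)

/-- Property (tac): every acyclic complex of f.g. projective modules is totally acyclic. -/
def PropTAC (R : Type) [CommRing R] : Prop :=
  ∀ C : FGProjComplex R, C.Acyclic → C.DualAcyclic

/-- `M` is an ∞-syzygy. -/
def IsInfiniteSyzygy (R : Type) [CommRing R]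
    (M : Type) [AddCommGroup M] [Module R M] : Prop :=
  Module.Finite R M ∧
  ∃ (k : ℕ → ℕ) (f : M →ₗ[R] (Fin (k 0) → R))
    (d : ∀ n : ℕ, (Fin (k n) → R) →ₗ[R] (Fin (k (n + 1)) → R)),
    Function.Injective f ∧ LinearMap.ker (d 0) = LinearMap.range f ∧
    ∀ n : ℕ, LinearMap.ker (d (n + 1)) = LinearMap.range (d n)

end

noncomputable section

/-- Minimal `n`-th syzygy: `IsMinimalSyzygy R n M K` says `K` is the `n`-th syzygy of `M`
computed from a minimal free resolution. -/
def IsMinimalSyzygy (R : Type) [CommRing R] [IsLocalRing R] :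
    ℕ → ModuleCat.{0} R → ModuleCat.{0} R → Prop
  | 0, M, K => Nonempty (K ≃ₗ[R] M)
  | n + 1, M, K => ∃ (m : ℕ) (f : (Fin m → R) →ₗ[R] M),
      Function.Surjective f ∧
      (LinearMap.ker f ≤ (maximalIdeal R) • (⊤ : Submodule R (Fin m → R))) ∧
      IsMinimalSyzygy R n (ModuleCat.of R (LinearMap.ker f)) K

/-- A resolving class of modules: contains `R`, closed under isomorphisms, direct summands,
extensions and syzygies. -/
def IsResolvingClass (R : Type) [CommRing R] (P : ModuleCat.{0} R → Prop) : Prop :=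
  (P (ModuleCat.of R R)) ∧
  (∀ X Y : ModuleCat.{0} R, Nonempty (X ≃ₗ[R] Y) → P X → P Y) ∧
  (∀ (X Y : ModuleCat.{0} R) (i : X →ₗ[R] Y) (r : Y →ₗ[R] X),
      r.comp i = LinearMap.id → P Y → P X) ∧
  (∀ (X Y Z : ModuleCat.{0} R) (f : X →ₗ[R] Y) (g : Y →ₗ[R] Z),
      Function.Injective f → Function.Surjective g → LinearMap.ker g = LinearMap.range f →
      P X → P Z → P Y) ∧
  (∀ (X Y : ModuleCat.{0} R) (m : ℕ) (f : (Fin m → R) →ₗ[R] X), Function.Surjective f →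
      Nonempty (Y ≃ₗ[R] LinearMap.ker f) → P X → P Y)

/-- `N` belongs to the resolving closure `res M`. -/
def InResolvingClosure (R : Type) [CommRing R] (M N : ModuleCat.{0} R) : Prop :=
  ∀ P : ModuleCat.{0} R → Prop, IsResolvingClass R P → P M → P N

/-- `M` has finite G-dimension: it admits a finite resolution by totally reflexive modules. -/
def HasFiniteGDim (R : Type) [CommRing R] (M : Type) [AddCommGroup M] [Module R M] : Prop :=
  ∃ (n : ℕ) (T : ℕ → ModuleCat.{0} R) (d : ∀ i : ℕ, T (i + 1) →ₗ[R] T i) (ε : T 0 →ₗ[R] M),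
    (∀ i, IsTotallyReflexive R (T i)) ∧ Function.Surjective ε ∧
    LinearMap.ker ε = LinearMap.range (d 0) ∧
    (∀ i, LinearMap.ker (d i) = LinearMap.range (d (i + 1))) ∧
    (∀ i > n, Subsingleton (T i))

/-- `ω` is a canonical module of the `d`-dimensional Cohen–Macaulay local ring `R`:
`Ext^i(k, ω)` vanishes for `i ≠ d` and is isomorphic to `k` for `i = d`. -/
def IsCanonicalModule (R : Type) [CommRing R] [IsLocalRing R] (d : ℕ)
    (ω : ModuleCat.{0} R) : Prop :=
  Module.Finite R ω ∧
  (∀ i : ℕ, i ≠ d → Subsingleton (ExtGroup R i (ModuleCat.of R (ResidueField R)) ω)) ∧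
  Nonempty ((ExtGroup R d (ModuleCat.of R (ResidueField R)) ω) ≃ₗ[R] (ResidueField R))

/-- Cohen–Macaulay local ring: depth equals Krull dimension. -/
def IsCohenMacaulayLocalRing (R : Type) [CommRing R] [IsLocalRing R] : Prop :=
  (rdepth R R : WithBot ℕ∞) = ringKrullDim R

end

lemma subsingleton_extGroup_iff (R : Type) [CommRing R] (M N : ModuleCat.{0} R) (n : ℕ) :
    Subsingleton (ExtGroup R (n + 1) M N) ↔ Subsingleton (Abelian.Ext M N (n + 1)) := by
  let P := projectiveResolution M
  have h₁ : Subsingleton (ExtGroup R (n + 1) M N) ↔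
      ∀ f : P.complex.X (n + 1) ⟶ N, P.complex.d (n + 2) (n + 1) ≫ f = 0 →
        ∃ g : P.complex.X n ⟶ N, P.complex.d (n + 1) n ≫ g = f := by
    rw [← ModuleCat.isZero_iff_subsingleton, ExtGroup, (P.isoExt (R := R) (n + 1) N).isZero_iff,
      ← HomologicalComplex.exactAt_iff_isZero_homology,
      HomologicalComplex.exactAt_iff' _ n (n + 1) (n + 2) (by simp) (by simp),
      ShortComplex.moduleCat_exact_iff]
    rfl
  rw [h₁]
  constructor
  · intro h
    refine subsingleton_of_forall_eq 0 fun α ↦ ?_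
    obtain ⟨f, hf, rfl⟩ := P.extMk_surjective α (n + 2) rfl
    exact (P.extMk_eq_zero_iff f (n + 2) rfl hf n rfl).2 (h f hf)
  · intro h f hf
    exact (P.extMk_eq_zero_iff f (n + 2) rfl hf n rfl).1 (Subsingleton.elim _ _)

section ShortExact

variable {C : Type*} [Category* C] [Abelian C] [HasExt C] {S : ShortComplex C}

lemma CategoryTheory.ShortComplex.ShortExact.subsingleton_ext_X₃_succ (hS : S.ShortExact) (Y : C)
    {n : ℕ} [Subsingleton (Abelian.Ext S.X₁ Y n)] [Subsingleton (Abelian.Ext S.X₂ Y (n + 1))] :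
    Subsingleton (Abelian.Ext S.X₃ Y (n + 1)) := by
  refine subsingleton_of_forall_eq 0 fun α ↦ ?_
  obtain ⟨β, rfl⟩ := Abelian.Ext.contravariant_sequence_exact₃ hS Y α
    (Subsingleton.elim _ _) (add_comm 1 n)
  rw [Subsingleton.elim β 0, Abelian.Ext.comp_zero]

lemma CategoryTheory.ShortComplex.ShortExact.subsingleton_ext_X₂ (hS : S.ShortExact) (Y : C)
    {n : ℕ} [Subsingleton (Abelian.Ext S.X₁ Y n)] [Subsingleton (Abelian.Ext S.X₃ Y n)] :
    Subsingleton (Abelian.Ext S.X₂ Y n) := by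
  refine subsingleton_of_forall_eq 0 fun α ↦ ?_
  obtain ⟨β, rfl⟩ := Abelian.Ext.contravariant_sequence_exact₂ hS Y α (Subsingleton.elim _ _)
  rw [Subsingleton.elim β 0, Abelian.Ext.comp_zero]

lemma CategoryTheory.ShortComplex.ShortExact.subsingleton_ext_X₃_one (hS : S.ShortExact) (Y : C)
    (h : ∀ a : S.X₁ ⟶ Y, ∃ b : S.X₂ ⟶ Y, S.f ≫ b = a)
    [Subsingleton (Abelian.Ext S.X₂ Y 1)] :
    Subsingleton (Abelian.Ext S.X₃ Y 1) := by
  refine subsingleton_of_forall_eq 0 fun α ↦ ?_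
  obtain ⟨β, rfl⟩ := Abelian.Ext.contravariant_sequence_exact₃ hS Y α
    (Subsingleton.elim _ _) (add_zero 1)
  obtain ⟨a, rfl⟩ := (Abelian.Ext.mk₀_bijective _ _).surjective β
  obtain ⟨b, rfl⟩ := h a
  rw [← Abelian.Ext.mk₀_comp_mk₀]
  exact hS.extClass_comp_assoc _

end ShortExact

section RelativeToRing

variable (R : Type) [CommRing R]

/-- The `R`-module `M` satisfies `Ext_R^i(M, R) = 0` for all `i > 0`. -/
def ExtToRingVanishes (M : Type) [AddCommGroup M] [Module R M] : Prop :=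
  ∀ n : ℕ, Subsingleton (Abelian.Ext (ModuleCat.of R M) (ModuleCat.of R R) (n + 1))

variable {R} {A B C M : Type} [AddCommGroup A] [Module R A] [AddCommGroup B] [Module R B]
  [AddCommGroup C] [Module R C] [AddCommGroup M] [Module R M]

lemma extToRingVanishes_iff : ExtToRingVanishes R M ↔
    ∀ i > 0, Subsingleton (ExtGroup R i (ModuleCat.of R M) (ModuleCat.of R R)) := by
  refine ⟨fun h i hi ↦ ?_, fun h n ↦ (subsingleton_extGroup_iff R _ _ n).1 (h _ n.succ_pos)⟩
  obtain ⟨n, rfl⟩ := Nat.exists_eq_add_of_lt hi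
  simpa only [zero_add] using (subsingleton_extGroup_iff R _ _ n).2 (h n)

lemma extToRingVanishes_of_projective [Module.Projective R M] : ExtToRingVanishes R M :=
  have := (IsProjective.iff_projective (R := R) M).1 inferInstance
  fun n ↦ Abelian.Ext.subsingleton_of_projective _ _ n

lemma shortExact_of_function_exact {f : A →ₗ[R] B} {g : B →ₗ[R] C} (hf : Function.Injective f)
    (hg : Function.Surjective g) (hfg : Function.Exact f g) :
    (ShortComplex.moduleCatMk f g hfg.linearMap_comp_eq_zero).ShortExact :=
  ModuleCat.shortComplex_shortExact _ hfg hf hg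

lemma subsingleton_ext_one_of_forall_extends {f : A →ₗ[R] B} {g : B →ₗ[R] C}
    (hf : Function.Injective f) (hg : Function.Surjective g) (hfg : Function.Exact f g)
    (h : ∀ a : Module.Dual R A, ∃ b : Module.Dual R B, b ∘ₗ f = a) (hB : ExtToRingVanishes R B) :
    Subsingleton (Abelian.Ext (ModuleCat.of R C) (ModuleCat.of R R) 1) := by
  have hS := shortExact_of_function_exact hf hg hfg
  have : Subsingleton (Abelian.Ext (ShortComplex.moduleCatMk f g
    hfg.linearMap_comp_eq_zero).X₂ (ModuleCat.of R R) 1) := hB 0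
  refine hS.subsingleton_ext_X₃_one _ fun a ↦ ?_
  obtain ⟨b, hb⟩ := h a.hom
  exact ⟨ModuleCat.ofHom b, ModuleCat.hom_ext hb⟩

lemma subsingleton_ext_add_two {f : A →ₗ[R] B} {g : B →ₗ[R] C}
    (hf : Function.Injective f) (hg : Function.Surjective g) (hfg : Function.Exact f g) (n : ℕ)
    (hA : Subsingleton (Abelian.Ext (ModuleCat.of R A) (ModuleCat.of R R) (n + 1)))
    (hB : ExtToRingVanishes R B) :
    Subsingleton (Abelian.Ext (ModuleCat.of R C) (ModuleCat.of R R) (n + 2)) := by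
  have hS := shortExact_of_function_exact hf hg hfg
  have : Subsingleton (Abelian.Ext (ShortComplex.moduleCatMk f g
    hfg.linearMap_comp_eq_zero).X₁ (ModuleCat.of R R) (n + 1)) := hA
  have : Subsingleton (Abelian.Ext (ShortComplex.moduleCatMk f g
    hfg.linearMap_comp_eq_zero).X₂ (ModuleCat.of R R) (n + 1 + 1)) := hB (n + 1)
  exact hS.subsingleton_ext_X₃_succ _

lemma ExtToRingVanishes.of_exact {f : A →ₗ[R] B} {g : B →ₗ[R] C}
    (hf : Function.Injective f) (hg : Function.Surjective g) (hfg : Function.Exact f g)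
    (h : ∀ a : Module.Dual R A, ∃ b : Module.Dual R B, b ∘ₗ f = a)
    (hA : ExtToRingVanishes R A) (hB : ExtToRingVanishes R B) : ExtToRingVanishes R C
  | 0 => subsingleton_ext_one_of_forall_extends hf hg hfg h hB
  | n + 1 => subsingleton_ext_add_two hf hg hfg n (hA n) hB

lemma ExtToRingVanishes.prod (hA : ExtToRingVanishes R A) (hB : ExtToRingVanishes R B) :
    ExtToRingVanishes R (A × B) := fun n ↦ by
  have hS := shortExact_of_function_exact (LinearMap.inl_injective (R := R) (M := A) (M₂ := B))
    LinearMap.snd_surjective .inl_snd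
  have : Subsingleton (Abelian.Ext (ShortComplex.moduleCatMk (.inl R A B) (.snd R A B)
    (Function.Exact.linearMap_comp_eq_zero .inl_snd)).X₁ (ModuleCat.of R R) (n + 1)) := hA n
  have : Subsingleton (Abelian.Ext (ShortComplex.moduleCatMk (.inl R A B) (.snd R A B)
    (Function.Exact.linearMap_comp_eq_zero .inl_snd)).X₃ (ModuleCat.of R R) (n + 1)) := hB n
  exact hS.subsingleton_ext_X₂ _

lemma ExtToRingVanishes.quotient_range {f : A →ₗ[R] B} (hf : Function.Injective f)
    (h : ∀ a : Module.Dual R A, ∃ b : Module.Dual R B, b ∘ₗ f = a)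
    (hA : ExtToRingVanishes R A) (hB : ExtToRingVanishes R B) :
    ExtToRingVanishes R (B ⧸ LinearMap.range f) :=
  .of_exact hf (Submodule.mkQ_surjective _) (LinearMap.exact_map_mkQ_range f) h hA hB

lemma exact_dualMap_mkQ_range (f : A →ₗ[R] B) :
    Function.Exact (LinearMap.range f).mkQ.dualMap f.dualMap := fun b ↦ by
  constructor
  · intro h
    exact ⟨(LinearMap.range f).liftQ b (LinearMap.range_le_ker_iff.2 h), LinearMap.ext fun _ ↦ rfl⟩
  · rintro ⟨c, rfl⟩
    change (c ∘ₗ (LinearMap.range f).mkQ) ∘ₗ f = 0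
    rw [LinearMap.comp_assoc, LinearMap.range_mkQ_comp, LinearMap.comp_zero]

/-- A finite module over a noetherian ring has a left approximation by a finite free module. -/
lemma exists_linearMap_forall_dual_extends [IsNoetherianRing R] [Module.Finite R M] :
    ∃ (n : ℕ) (φ : M →ₗ[R] (Fin n → R)),
      ∀ a : Module.Dual R M, ∃ b : Module.Dual R (Fin n → R), b ∘ₗ φ = a := by
  obtain ⟨n, s, hs⟩ := Module.Finite.exists_fin (R := R) (M := Module.Dual R M)
  refine ⟨n, LinearMap.pi s, fun a ↦ ?_⟩
  obtain ⟨c, rfl⟩ := (Submodule.mem_span_range_iff_exists_fun R).1 (hs ▸ Submodule.mem_top (x := a))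
  refine ⟨∑ i, c i • LinearMap.proj i, ?_⟩
  ext m
  simp

lemma IsSMulRegular.of_dual_eval_injective {x : R}
    (hx : IsSMulRegular R x) (hM : Function.Injective (Module.Dual.eval R M)) :
    IsSMulRegular M x := fun m m' h ↦ hM <| LinearMap.ext fun a ↦ hx <| by
  simpa using congr_arg a h

end RelativeToRing

section Local

variable {R : Type} [CommRing R] [IsLocalRing R]

lemma rdepth_pos_iff {M : Type} [AddCommGroup M] [Module R M] [Module.Finite R M] :
    0 < rdepth R M ↔ Subsingleton M ∨ ∃ x ∈ maximalIdeal R, IsSMulRegular M x := by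
  rcases subsingleton_or_nontrivial M with hM | hM
  · simp [rdepth, hM]
  · rw [rdepth, if_neg (not_subsingleton M), lt_sSup_iff]
    simp only [not_subsingleton M, false_or]
    constructor
    · rintro ⟨_, ⟨_ | ⟨x, rs⟩, rfl, hrs, hreg⟩, hpos⟩
      · simp at hpos
      · exact ⟨x, hrs x (by simp),
          ((RingTheory.Sequence.isWeaklyRegular_cons_iff M x rs).1 hreg.toIsWeaklyRegular).1⟩
    · rintro ⟨x, hx, hreg⟩
      refine ⟨_, ⟨[x], rfl, by simpa, ?_⟩, by simp⟩
      rw [IsLocalRing.isRegular_iff_isWeaklyRegular_of_subset_maximalIdeal (by simpa)]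
      exact .cons hreg (.nil _ _)

variable [IsNoetherianRing R]

lemma exists_pow_smul_ne {M : Type} [AddCommGroup M] [Module R M] [Module.Finite R M] {x : R}
    (hx : x ∈ maximalIdeal R) {z : M} (hz : z ≠ 0) : ∃ k : ℕ, ∀ m : M, x ^ k • m ≠ z := by
  by_contra! h
  refine hz ((Submodule.mem_bot R).1 ?_)
  rw [← Ideal.iInf_pow_smul_eq_bot_of_isLocalRing (M := M) (maximalIdeal R)
    (maximalIdeal.isMaximal R).ne_top, Submodule.mem_iInf]
  intro k
  obtain ⟨m, rfl⟩ := h k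
  exact Submodule.smul_mem_smul (Ideal.pow_mem_pow hx k) trivial

variable (H : ∀ (M : Type) [AddCommGroup M] [Module R M], Module.Finite R M →
  ExtToRingVanishes R M → Subsingleton M ∨ ∃ x ∈ maximalIdeal R, IsSMulRegular M x)
include H

/-- The element `z` is followed through cokernels of maps `(x ^ k, φ) : M → M × Rⁿ`, in which
it stays nonzero and invisible to functionals while its annihilator grows. -/
lemma dual_eval_injective_of_forall_exists_isSMulRegular (M : Type) [AddCommGroup M] [Module R M]
    [Module.Finite R M] (hM : ExtToRingVanishes R M) :
    Function.Injective (Module.Dual.eval R M) := by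
  suffices key : ∀ (I : Ideal R) (M : Type) [AddCommGroup M] [Module R M] [Module.Finite R M],
      ExtToRingVanishes R M → ∀ z : M, (∀ a : Module.Dual R M, a z = 0) →
      Ideal.torsionOf R M z = I → z = 0 by
    refine (injective_iff_map_eq_zero _).2 fun z hz ↦ key _ M hM z (fun a ↦ ?_) rfl
    simpa using LinearMap.congr_fun hz a
  intro I
  induction I using WellFoundedGT.induction with
  | ind I ih =>
  rintro M _ _ _ hM z hz rfl
  by_contra hz₀
  have : Nontrivial M := ⟨z, 0, hz₀⟩
  obtain ⟨x, hx, hreg⟩ := (H M inferInstance hM).resolve_left (not_subsingleton M)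
  obtain ⟨k, hk⟩ := exists_pow_smul_ne hx hz₀
  obtain ⟨n, φ, hφ⟩ := exists_linearMap_forall_dual_extends (R := R) (M := M)
  have hφz : φ z = 0 := funext fun i ↦ hz (LinearMap.proj i ∘ₗ φ)
  let f : M →ₗ[R] M × (Fin n → R) := (x ^ k • LinearMap.id).prod φ
  have hf : Function.Injective f := fun m m' h ↦ hreg.pow k (congr_arg Prod.fst h)
  have hC : ExtToRingVanishes R ((M × (Fin n → R)) ⧸ LinearMap.range f) := by
    refine .quotient_range hf (fun a ↦ ?_) hM (hM.prod extToRingVanishes_of_projective)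
    obtain ⟨b, rfl⟩ := hφ a
    exact ⟨b ∘ₗ .snd R M _, rfl⟩
  let ι : M →ₗ[R] (M × (Fin n → R)) ⧸ LinearMap.range f := Submodule.mkQ _ ∘ₗ .inl R M _
  have hιz : ι z ≠ 0 := by
    intro h
    obtain ⟨m, hm⟩ := (Submodule.Quotient.mk_eq_zero _).1 h
    exact hk m (congr_arg Prod.fst hm)
  have hxz : x ^ k • ι z = 0 :=
    (Submodule.Quotient.mk_eq_zero _).2 ⟨z, Prod.ext rfl (by simpa [f] using hφz)⟩
  refine hιz (ih _ ?_ _ hC (ι z) (fun a ↦ hz (a ∘ₗ ι)) rfl)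
  refine lt_of_le_of_ne (fun r hr ↦ ?_) fun h ↦ ?_
  · rw [Ideal.mem_torsionOf_iff] at hr ⊢
    rw [← map_smul, hr, map_zero]
  · have hmem : x ^ k ∈ Ideal.torsionOf R M z := h ▸ (Ideal.mem_torsionOf_iff _ _).2 hxz
    exact hz₀ (hreg.pow k (by simpa [Ideal.mem_torsionOf_iff] using hmem))

/-- An embedding into a finite free module through which every functional factors, with cokernel
again of vanishing `Ext` into the ring. -/
lemma exists_injective_forall_dual_extends (M : Type) [AddCommGroup M] [Module R M]
    [Module.Finite R M] (hM : ExtToRingVanishes R M) :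
    ∃ (n : ℕ) (φ : M →ₗ[R] (Fin n → R)), Function.Injective φ ∧
      (∀ a : Module.Dual R M, ∃ b : Module.Dual R (Fin n → R), b ∘ₗ φ = a) ∧
      ExtToRingVanishes R ((Fin n → R) ⧸ LinearMap.range φ) := by
  obtain ⟨n, φ, hφ⟩ := exists_linearMap_forall_dual_extends (R := R) (M := M)
  have hinj : Function.Injective φ := (injective_iff_map_eq_zero _).2 fun z hz ↦ by
    refine dual_eval_injective_of_forall_exists_isSMulRegular H M hM (LinearMap.ext fun a ↦ ?_)
    obtain ⟨b, rfl⟩ := hφ a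
    simp [hz]
  exact ⟨n, φ, hinj, hφ, .quotient_range hinj hφ hM extToRingVanishes_of_projective⟩

lemma dual_eval_bijective_of_forall_exists_isSMulRegular (M : Type) [AddCommGroup M] [Module R M]
    [Module.Finite R M] (hM : ExtToRingVanishes R M) :
    Function.Bijective (Module.Dual.eval R M) := by
  refine ⟨dual_eval_injective_of_forall_exists_isSMulRegular H M hM, fun e ↦ ?_⟩
  obtain ⟨n, φ, -, hφ, hC⟩ := exists_injective_forall_dual_extends H M hM
  obtain ⟨z, hz⟩ := (Module.bijective_dual_eval R (Fin n → R)).surjective (e ∘ₗ φ.dualMap)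
  have hz' (b : Module.Dual R (Fin n → R)) : b z = e (b ∘ₗ φ) := LinearMap.congr_fun hz b
  have hzC : (LinearMap.range φ).mkQ z = 0 := by
    refine dual_eval_injective_of_forall_exists_isSMulRegular H _ hC (LinearMap.ext fun c ↦ ?_)
    have := hz' (c ∘ₗ (LinearMap.range φ).mkQ)
    rw [LinearMap.comp_assoc, LinearMap.range_mkQ_comp, LinearMap.comp_zero, map_zero] at this
    simpa using this
  obtain ⟨m, rfl⟩ := (Submodule.Quotient.mk_eq_zero _).1 hzC
  refine ⟨m, LinearMap.ext fun a ↦ ?_⟩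
  obtain ⟨b, rfl⟩ := hφ a
  exact hz' b

lemma extToRingVanishes_dual_of_forall_exists_isSMulRegular (M : Type) [AddCommGroup M]
    [Module R M] [Module.Finite R M] (hM : ExtToRingVanishes R M) :
    ExtToRingVanishes R (Module.Dual R M) := by
  intro k
  induction k generalizing M with
  | zero =>
    obtain ⟨n, φ, -, hφ, hC⟩ := exists_injective_forall_dual_extends H M hM
    refine subsingleton_ext_one_of_forall_extends (f := (LinearMap.range φ).mkQ.dualMap)
      (g := φ.dualMap) (LinearMap.dualMap_injective_of_surjective (Submodule.mkQ_surjective _)) hφ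
      (exact_dualMap_mkQ_range φ) (fun e ↦ ?_) extToRingVanishes_of_projective
    obtain ⟨c, rfl⟩ := (dual_eval_bijective_of_forall_exists_isSMulRegular H _ hC).surjective e
    obtain ⟨z, rfl⟩ := Submodule.mkQ_surjective _ c
    exact ⟨Module.Dual.eval R _ z, rfl⟩
  | succ k ih =>
    obtain ⟨n, φ, -, hφ, hC⟩ := exists_injective_forall_dual_extends H M hM
    exact subsingleton_ext_add_two (f := (LinearMap.range φ).mkQ.dualMap)
      (g := φ.dualMap) (LinearMap.dualMap_injective_of_surjective (Submodule.mkQ_surjective _)) hφ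
      (exact_dualMap_mkQ_range φ) k (ih _ hC) extToRingVanishes_of_projective

end Local

/-- over a local ring of positive depth, (tr) holds iff every finitely
generated module with `Ext^{>0}(M,R) = 0` has positive depth. -/
theorem stmt14 (R : Type) [CommRing R] [IsLocalRing R] [IsNoetherianRing R]
    (hR : 0 < rdepth R R) :
    PropTR R ↔
      ∀ (M : Type) [AddCommGroup M] [Module R M], Module.Finite R M →
        (∀ i > 0, Subsingleton (ExtGroup R i (ModuleCat.of R M) (ModuleCat.of R R))) →
        0 < rdepth R M := by
  constructor
  · intro h M _ _ hM hExt
    obtain ⟨x, hx, hreg⟩ := (rdepth_pos_iff.1 hR).resolve_left (not_subsingleton R)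
    exact rdepth_pos_iff.2 (.inr ⟨x, hx, hreg.of_dual_eval_injective (h M hM hExt).2.1.1⟩)
  · intro h M _ _ hM hExt
    have H (N : Type) [AddCommGroup N] [Module R N] (hN : Module.Finite R N)
        (hNExt : ExtToRingVanishes R N) :=
      rdepth_pos_iff.1 (h N hN (extToRingVanishes_iff.1 hNExt))
    have hM' := extToRingVanishes_iff.2 hExt
    exact ⟨hM, dual_eval_bijective_of_forall_exists_isSMulRegular H M hM', hExt,
      extToRingVanishes_iff.1 (extToRingVanishes_dual_of_forall_exists_isSMulRegular H M hM')⟩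
end

section
/- Let $R$ be a Cohen--Macaulay commutative noetherian local ring of positive dimension. If $R$ satisfies the depth formula property (dep), then $R$ satisfies property (tr): every finitely generated $R$-module $M$ with $\operatorname{Ext}_R^i(M,R)=0$ for all $i>0$ is totally reflexive. -/
open CategoryTheory IsLocalRing

/-- A sequence of finite free modules and linear maps, exact in positive degrees. -/
structure FreeSeq (R : Type) [CommRing R] where
  k : ℕ → ℕ
  d : ∀ n, (Fin (k (n + 1)) → R) →ₗ[R] (Fin (k n) → R)
  exact : ∀ n, Function.Exact (d (n + 1)) (d n)

namespace FreeSeq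

variable {R : Type} [CommRing R] (F : FreeSeq R)

/-- The free module in degree `n`. -/
abbrev X (n : ℕ) : Type := Fin (F.k n) → R

/-- Dropping the term in degree `0`. -/
def shift : FreeSeq R where
  k n := F.k (n + 1)
  d n := F.d (n + 1)
  exact n := F.exact (n + 1)

/-- `F` is a free resolution of `M` with augmentation `ε`. -/
structure Resolves {M : Type} [AddCommGroup M] [Module R M] (ε : F.X 0 →ₗ[R] M) : Prop where
  surj : Function.Surjective ε
  exact : Function.Exact (F.d 0) ε

/-- `L ⊗ F` is exact in degree `i + 1`. -/
def TorVanish (L : Type) [AddCommGroup L] [Module R L] (i : ℕ) : Prop :=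
  Function.Exact ((F.d (i + 1)).lTensor L) ((F.d i).lTensor L)

/-- `Hom(F, N)` is exact in degree `i + 1`. -/
def ExtVanish (N : Type) [AddCommGroup N] [Module R N] (i : ℕ) : Prop :=
  Function.Exact ((F.d i).lcomp R N) ((F.d (i + 1)).lcomp R N)

/-- The associated chain complex. -/
noncomputable abbrev toComplex : ChainComplex (ModuleCat.{0} R) ℕ :=
  ChainComplex.of (fun n => ModuleCat.of R (F.X n)) (fun n => ModuleCat.ofHom (F.d n))
    (fun n => by
      rw [← ModuleCat.ofHom_comp, (F.exact n).linearMap_comp_eq_zero]; rfl)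

lemma toComplex_d (n : ℕ) : F.toComplex.d (n + 1) n = ModuleCat.ofHom (F.d n) :=
  ChainComplex.of_d (fun n => ModuleCat.of R (F.X n)) (fun n => ModuleCat.ofHom (F.d n)) n

lemma exactAt_toComplex (n : ℕ) : F.toComplex.ExactAt (n + 1) := by
  rw [HomologicalComplex.exactAt_iff' _ (n + 2) (n + 1) n (by simp) (by simp),
    ShortComplex.ShortExact.moduleCat_exact_iff_function_exact]
  change Function.Exact (F.toComplex.d (n + 2) (n + 1)).hom (F.toComplex.d (n + 1) n).hom
  rw [toComplex_d, toComplex_d]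
  exact F.exact n

variable {F} {M : Type} [AddCommGroup M] [Module R M] {ε : F.X 0 →ₗ[R] M}

/-- The projective resolution associated with a free resolution. -/
noncomputable def Resolves.projectiveResolution (h : F.Resolves ε) :
    ProjectiveResolution (ModuleCat.of R M) where
  complex := F.toComplex
  projective n := by
    have : Module.Projective R (F.X n) := inferInstance
    exact (IsProjective.iff_projective (F.X n)).mp this
  π := (ChainComplex.toSingle₀Equiv _ _).symm ⟨ModuleCat.ofHom ε, by
    rw [toComplex_d, ← ModuleCat.ofHom_comp, h.exact.linearMap_comp_eq_zero]; rfl⟩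
  quasiIso := ⟨fun n => by
    cases n with
    | zero =>
      rw [ChainComplex.quasiIsoAt₀_iff, ShortComplex.quasiIso_iff_of_zeros']
      · refine ⟨?_, ?_⟩
        · rw [ShortComplex.ShortExact.moduleCat_exact_iff_function_exact]
          change Function.Exact (F.toComplex.d 1 0).hom
            (((ChainComplex.toSingle₀Equiv F.toComplex (ModuleCat.of R M)).symm
              ⟨ModuleCat.ofHom ε, _⟩).f 0).hom
          rw [ChainComplex.toSingle₀Equiv_symm_apply_f_zero, toComplex_d]
          exact h.exact
        · dsimp
          exact (ModuleCat.epi_iff_surjective _).mpr h.surj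
      all_goals rfl
    | succ n =>
      rw [quasiIsoAt_iff_exactAt']
      · exact F.exactAt_toComplex n
      · apply ChainComplex.exactAt_succ_single_obj⟩

lemma Resolves.subsingleton_torGroup_iff (h : F.Resolves ε) (L : Type) [AddCommGroup L]
    [Module R L] (i : ℕ) :
    Subsingleton (TorGroup R (i + 1) (ModuleCat.of R L) (ModuleCat.of R M)) ↔
      F.TorVanish L i := by
  let e := h.projectiveResolution.isoLeftDerivedObj
    ((MonoidalCategory.tensoringLeft (ModuleCat.{0} R)).obj (ModuleCat.of R L)) (i + 1)
  rw [show TorGroup R (i + 1) (ModuleCat.of R L) (ModuleCat.of R M) =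
    (((MonoidalCategory.tensoringLeft (ModuleCat.{0} R)).obj (ModuleCat.of R L)).leftDerived
      (i + 1)).obj (ModuleCat.of R M) from rfl]
  rw [← ModuleCat.isZero_iff_subsingleton, e.isZero_iff]
  erw [← HomologicalComplex.exactAt_iff_isZero_homology,
    HomologicalComplex.exactAt_iff' _ (i + 2) (i + 1) i (by simp) (by simp),
    ShortComplex.ShortExact.moduleCat_exact_iff_function_exact]
  change Function.Exact ((F.toComplex.d (i + 2) (i + 1)).hom.lTensor L)
    ((F.toComplex.d (i + 1) i).hom.lTensor L) ↔ _
  rw [toComplex_d, toComplex_d]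
  rfl

lemma Resolves.subsingleton_extGroup_iff (h : F.Resolves ε) (N : Type) [AddCommGroup N]
    [Module R N] (i : ℕ) :
    Subsingleton (ExtGroup R (i + 1) (ModuleCat.of R M) (ModuleCat.of R N)) ↔
      F.ExtVanish N i := by
  rw [ExtGroup, ← ModuleCat.isZero_iff_subsingleton,
    (h.projectiveResolution.isoExt (i + 1) (ModuleCat.of R N)).isZero_iff,
    ← HomologicalComplex.exactAt_iff_isZero_homology,
    HomologicalComplex.exactAt_iff' _ i (i + 1) (i + 2) (by simp) (by simp),
    ShortComplex.ShortExact.moduleCat_exact_iff_function_exact]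
  change Function.Exact (fun f : F.toComplex.X i ⟶ ModuleCat.of R N => F.toComplex.d (i + 1) i ≫ f)
    (fun f : F.toComplex.X (i + 1) ⟶ ModuleCat.of R N => F.toComplex.d (i + 2) (i + 1) ≫ f) ↔ _
  rw [toComplex_d, toComplex_d]
  constructor
  · intro H f
    refine ⟨fun hf => ?_, ?_⟩
    · obtain ⟨g, hg⟩ := (H (ModuleCat.ofHom f)).1 (ModuleCat.hom_ext hf)
      exact ⟨g.hom, congrArg ModuleCat.Hom.hom hg⟩
    · rintro ⟨g, rfl⟩
      exact congrArg ModuleCat.Hom.hom ((H (ModuleCat.ofHom (LinearMap.lcomp R N (F.d i) g))).2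
        ⟨ModuleCat.ofHom g, rfl⟩)
  · intro H f
    refine ⟨fun hf => ?_, ?_⟩
    · obtain ⟨g, hg⟩ := (H f.hom).1 (congrArg ModuleCat.Hom.hom hf)
      exact ⟨ModuleCat.ofHom g, ModuleCat.hom_ext hg⟩
    · rintro ⟨g, rfl⟩
      exact ModuleCat.hom_ext ((H _).2 ⟨g.hom, rfl⟩)

end FreeSeq

section Chase

variable {R : Type} [CommRing R] {A₁ A₂ A₃ A₄ B₁ B₂ B₃ B₄ C₁ C₂ C₃ : Type}
  [AddCommGroup A₁] [AddCommGroup A₂] [AddCommGroup A₃] [AddCommGroup A₄]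
  [AddCommGroup B₁] [AddCommGroup B₂] [AddCommGroup B₃] [AddCommGroup B₄]
  [AddCommGroup C₁] [AddCommGroup C₂] [AddCommGroup C₃]
  [Module R A₁] [Module R A₂] [Module R A₃] [Module R A₄]
  [Module R B₁] [Module R B₂] [Module R B₃] [Module R B₄]
  [Module R C₁] [Module R C₂] [Module R C₃]

lemma exact_of_shortExact_right
    {α₂ : A₂ →ₗ[R] A₃} {α₃ : A₃ →ₗ[R] A₄}
    {β₁ : B₁ →ₗ[R] B₂} {β₂ : B₂ →ₗ[R] B₃} {β₃ : B₃ →ₗ[R] B₄}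
    {γ₁ : C₁ →ₗ[R] C₂} {γ₂ : C₂ →ₗ[R] C₃}
    {f₂ : A₂ →ₗ[R] B₂} {f₃ : A₃ →ₗ[R] B₃} {f₄ : A₄ →ₗ[R] B₄}
    {g₁ : B₁ →ₗ[R] C₁} {g₂ : B₂ →ₗ[R] C₂} {g₃ : B₃ →ₗ[R] C₃}
    (hβ : Function.Exact β₁ β₂) (hα : Function.Exact α₂ α₃)
    (hββ : ∀ b, β₃ (β₂ b) = 0) (hγγ : ∀ c, γ₂ (γ₁ c) = 0)
    (hg₂ : Function.Surjective g₂) (hf₄ : Function.Injective f₄)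
    (e₂ : ∀ a, g₂ (f₂ a) = 0) (e₃ : Function.Exact f₃ g₃)
    (cf₂ : ∀ a, β₂ (f₂ a) = f₃ (α₂ a)) (cf₃ : ∀ a, β₃ (f₃ a) = f₄ (α₃ a))
    (cg₁ : ∀ b, γ₁ (g₁ b) = g₂ (β₁ b)) (cg₂ : ∀ b, γ₂ (g₂ b) = g₃ (β₂ b)) :
    Function.Exact γ₁ γ₂ := by
  intro c
  refine ⟨fun hc => ?_, ?_⟩
  · obtain ⟨b, rfl⟩ := hg₂ c
    rw [cg₂] at hc
    obtain ⟨a, ha⟩ := (e₃ _).1 hc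
    have ha' : α₃ a = 0 := hf₄ (by rw [← cf₃, ha, hββ, map_zero])
    obtain ⟨a', rfl⟩ := (hα _).1 ha'
    have : β₂ (b - f₂ a') = 0 := by rw [map_sub, cf₂, ha, sub_self]
    obtain ⟨b', hb'⟩ := (hβ _).1 this
    exact ⟨g₁ b', by rw [cg₁, hb', map_sub, e₂, sub_zero]⟩
  · rintro ⟨c, rfl⟩
    exact hγγ c

lemma exact_of_shortExact_left
    {α₂ : A₂ →ₗ[R] A₃} {α₃ : A₃ →ₗ[R] A₄}
    {β₁ : B₁ →ₗ[R] B₂} {β₂ : B₂ →ₗ[R] B₃} {β₃ : B₃ →ₗ[R] B₄}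
    {γ₁ : C₁ →ₗ[R] C₂} {γ₂ : C₂ →ₗ[R] C₃}
    {f₂ : A₂ →ₗ[R] B₂} {f₃ : A₃ →ₗ[R] B₃} {f₄ : A₄ →ₗ[R] B₄}
    {g₁ : B₁ →ₗ[R] C₁} {g₂ : B₂ →ₗ[R] C₂} {g₃ : B₃ →ₗ[R] C₃}
    (hβ : Function.Exact β₂ β₃) (hγ : Function.Exact γ₁ γ₂)
    (hββ : ∀ b, β₂ (β₁ b) = 0) (hαα : ∀ a, α₃ (α₂ a) = 0)
    (hg₁ : Function.Surjective g₁) (hf₃ : Function.Injective f₃)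
    (e₂ : Function.Exact f₂ g₂) (e₃ : ∀ a, g₃ (f₃ a) = 0)
    (cf₂ : ∀ a, β₂ (f₂ a) = f₃ (α₂ a)) (cf₃ : ∀ a, β₃ (f₃ a) = f₄ (α₃ a))
    (cg₁ : ∀ b, γ₁ (g₁ b) = g₂ (β₁ b)) (cg₂ : ∀ b, γ₂ (g₂ b) = g₃ (β₂ b)) :
    Function.Exact α₂ α₃ := by
  intro a
  refine ⟨fun ha => ?_, ?_⟩
  · have h1 : β₃ (f₃ a) = 0 := by rw [cf₃, ha, map_zero]
    obtain ⟨b, hb⟩ := (hβ _).1 h1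
    have h2 : γ₂ (g₂ b) = 0 := by rw [cg₂, hb, e₃]
    obtain ⟨c, hc⟩ := (hγ _).1 h2
    obtain ⟨b', rfl⟩ := hg₁ c
    have h3 : g₂ (b - β₁ b') = 0 := by rw [map_sub, ← hc, cg₁, sub_self]
    obtain ⟨a', ha'⟩ := (e₂ _).1 h3
    exact ⟨a', hf₃ (by rw [← cf₂, ha', map_sub, hββ, hb, sub_zero])⟩
  · rintro ⟨a, rfl⟩
    exact hαα a

end Chase

namespace FreeSeq

variable {R : Type} [CommRing R] (F : FreeSeq R)

lemma d_d (n : ℕ) (x : F.X (n + 2)) : F.d n (F.d (n + 1) x) = 0 :=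
  (F.exact n).apply_apply_eq_zero x

lemma lTensor_d_d (L : Type) [AddCommGroup L] [Module R L] (n : ℕ)
    (x : TensorProduct R L (F.X (n + 2))) :
    (F.d n).lTensor L ((F.d (n + 1)).lTensor L x) = 0 := by
  rw [← LinearMap.comp_apply, ← LinearMap.lTensor_comp, (F.exact n).linearMap_comp_eq_zero,
    LinearMap.lTensor_zero, LinearMap.zero_apply]

lemma lcomp_d_d (N : Type) [AddCommGroup N] [Module R N] (n : ℕ) (x : F.X n →ₗ[R] N) :
    (F.d (n + 1)).lcomp R N ((F.d n).lcomp R N x) = 0 :=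
  LinearMap.ext fun y => (congrArg x (F.d_d n y)).trans (map_zero x)

lemma lTensor_rTensor_comm {A B P Q : Type} [AddCommGroup A] [AddCommGroup B]
    [AddCommGroup P] [AddCommGroup Q] [Module R A] [Module R B] [Module R P] [Module R Q]
    (f : A →ₗ[R] B) (d : P →ₗ[R] Q) (x : TensorProduct R A P) :
    d.lTensor B (f.rTensor P x) = f.rTensor Q (d.lTensor A x) := by
  rw [← LinearMap.comp_apply, ← LinearMap.comp_apply, LinearMap.lTensor_comp_rTensor,
    LinearMap.rTensor_comp_lTensor]

variable {F} {A B C : Type} [AddCommGroup A] [AddCommGroup B] [AddCommGroup C]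
  [Module R A] [Module R B] [Module R C] {f : A →ₗ[R] B} {g : B →ₗ[R] C}

lemma TorVanish.of_shortExact_right (hf : Function.Injective f) (hg : Function.Surjective g)
    (hfg : Function.Exact f g) {i : ℕ} (hA : F.TorVanish A i) (hB : F.TorVanish B (i + 1)) :
    F.TorVanish C (i + 1) :=
  exact_of_shortExact_right (f₂ := f.rTensor _) (f₃ := f.rTensor _) (f₄ := f.rTensor _)
    (g₁ := g.rTensor _) (g₂ := g.rTensor _) (g₃ := g.rTensor _)
    (β₃ := (F.d i).lTensor B) hB hA
    (F.lTensor_d_d B i) (F.lTensor_d_d C (i + 1)) (LinearMap.rTensor_surjective _ hg)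
    (Module.Flat.rTensor_preserves_injective_linearMap _ hf)
    (rTensor_exact _ hfg hg).apply_apply_eq_zero (rTensor_exact _ hfg hg)
    (lTensor_rTensor_comm _ _) (lTensor_rTensor_comm _ _) (lTensor_rTensor_comm _ _)
    (lTensor_rTensor_comm _ _)

lemma TorVanish.of_shortExact_left (hf : Function.Injective f) (hg : Function.Surjective g)
    (hfg : Function.Exact f g) {i : ℕ} (hB : F.TorVanish B i) (hC : F.TorVanish C (i + 1)) :
    F.TorVanish A i :=
  exact_of_shortExact_left (f₂ := f.rTensor _) (f₃ := f.rTensor _) (f₄ := f.rTensor _)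
    (g₁ := g.rTensor _) (g₂ := g.rTensor _) (g₃ := g.rTensor _)
    hB hC (F.lTensor_d_d B (i + 1)) (F.lTensor_d_d A i)
    (LinearMap.rTensor_surjective _ hg)
    (Module.Flat.rTensor_preserves_injective_linearMap _ hf)
    (rTensor_exact _ hfg hg) (rTensor_exact _ hfg hg).apply_apply_eq_zero
    (lTensor_rTensor_comm _ _) (lTensor_rTensor_comm _ _) (lTensor_rTensor_comm _ _)
    (lTensor_rTensor_comm _ _)

lemma compRight_exact {P : Type} [AddCommGroup P] [Module R P] [Module.Projective R P]
    (hfg : Function.Exact f g) :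
    Function.Exact (f.compRight R : (P →ₗ[R] A) →ₗ[R] P →ₗ[R] B)
      (g.compRight R : (P →ₗ[R] B) →ₗ[R] P →ₗ[R] C) := by
  intro h
  refine ⟨fun hh => ?_, ?_⟩
  · have hr : ∀ x, h x ∈ LinearMap.range f := fun x => (hfg _).1 (LinearMap.congr_fun hh x)
    obtain ⟨h', hh'⟩ := Module.projective_lifting_property f.rangeRestrict
      (h.codRestrict _ hr) f.surjective_rangeRestrict
    refine ⟨h', LinearMap.ext fun x => ?_⟩
    exact congrArg Subtype.val (LinearMap.congr_fun hh' x)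
  · rintro ⟨h, rfl⟩
    exact LinearMap.ext fun x => hfg.apply_apply_eq_zero _

lemma ExtVanish.of_shortExact_right (hf : Function.Injective f) (hg : Function.Surjective g)
    (hfg : Function.Exact f g) {i : ℕ} (hA : F.ExtVanish A (i + 1)) (hB : F.ExtVanish B i) :
    F.ExtVanish C i :=
  exact_of_shortExact_right (f₂ := f.compRight R) (f₃ := f.compRight R) (f₄ := f.compRight R)
    (g₁ := g.compRight R) (g₂ := g.compRight R) (g₃ := g.compRight R)
    (β₃ := (F.d (i + 2)).lcomp R B) hB hA
    (F.lcomp_d_d B (i + 1)) (F.lcomp_d_d C i)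
    (fun h => Module.projective_lifting_property g h hg)
    (fun _ _ hab => LinearMap.ext fun x => hf (LinearMap.congr_fun hab x))
    (compRight_exact hfg).apply_apply_eq_zero (compRight_exact hfg)
    (fun _ => rfl) (fun _ => rfl) (fun _ => rfl) (fun _ => rfl)

lemma torVanish_of_flat [Module.Flat R A] (i : ℕ) : F.TorVanish A i :=
  Module.Flat.lTensor_exact A (F.exact i)

/-- A surjection from a finite free module onto a finite module. -/
lemma exists_finite_cover (M : Type) [AddCommGroup M] [Module R M] [Module.Finite R M] :
    ∃ (n : ℕ) (f : (Fin n → R) →ₗ[R] M), Function.Surjective f :=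
  Module.Finite.exists_fin' R M

/-- A surjection from a finite free module onto the kernel of a map out of one. -/
lemma exists_cover_ker [IsNoetherianRing R] {n : ℕ} {M : Type} [AddCommGroup M] [Module R M]
    (f : (Fin n → R) →ₗ[R] M) :
    ∃ (m : ℕ) (g : (Fin m → R) →ₗ[R] (Fin n → R)), Function.Exact g f := by
  obtain ⟨m, g, hg⟩ := Module.Finite.exists_fin' R (LinearMap.ker f)
  refine ⟨m, (LinearMap.ker f).subtype ∘ₗ g, ?_⟩
  rw [LinearMap.exact_iff, LinearMap.range_comp, LinearMap.range_eq_top.mpr hg]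
  simp

/-- A composable pair presented by one map of finite free modules, used to build resolutions. -/
structure Stage (R : Type) [CommRing R] where
  a : ℕ
  b : ℕ
  f : (Fin b → R) →ₗ[R] (Fin a → R)

/-- The next map of a free resolution. -/
noncomputable def Stage.next [IsNoetherianRing R] (s : Stage R) : Stage R where
  a := s.b
  b := (exists_cover_ker s.f).choose
  f := (exists_cover_ker s.f).choose_spec.choose

/-- The stages of a free resolution starting with a given map. -/
noncomputable def Stage.iter [IsNoetherianRing R] (s : Stage R) : ℕ → Stage R
  | 0 => s
  | n + 1 => (s.iter n).next

/-- A free resolution starting with a given map. -/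
noncomputable def ofStage [IsNoetherianRing R] (s : Stage R) : FreeSeq R where
  k n := (s.iter n).a
  d n := (s.iter n).f
  exact n := (exists_cover_ker (s.iter n).f).choose_spec.choose_spec

lemma exists_resolves [IsNoetherianRing R] (M : Type) [AddCommGroup M] [Module R M]
    [Module.Finite R M] : ∃ (F : FreeSeq R) (ε : F.X 0 →ₗ[R] M), F.Resolves ε := by
  obtain ⟨a, ε, hε⟩ := exists_finite_cover (R := R) M
  obtain ⟨b, f, hf⟩ := exists_cover_ker ε
  exact ⟨ofStage ⟨a, b, f⟩, ε, hε, hf⟩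

end FreeSeq

namespace FreeSeq

open RingTheory.Sequence Pointwise

variable {R : Type} [CommRing R] {F : FreeSeq R} {M N Q : Type} [AddCommGroup M] [AddCommGroup N]
  [AddCommGroup Q] [Module R M] [Module R N] [Module R Q]

lemma ExtVanish.of_equiv (e : N ≃ₗ[R] Q) {i : ℕ} (h : F.ExtVanish N i) : F.ExtVanish Q i := by
  refine ExtVanish.of_shortExact_right (A := PUnit) (f := 0) (g := e.toLinearMap)
    (Function.injective_of_subsingleton _) e.surjective (fun x => ?_) (fun x => ?_) h
  · refine ⟨fun hx => ⟨0, ?_⟩, ?_⟩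
    · rw [LinearMap.zero_apply, e.injective (hx.trans e.map_zero.symm)]
    · rintro ⟨y, rfl⟩
      exact e.map_zero
  · exact ⟨fun _ => ⟨0, Subsingleton.elim _ _⟩, fun _ => Subsingleton.elim _ _⟩

lemma TorVanish.of_equiv (e : N ≃ₗ[R] Q) {i : ℕ} (h : F.TorVanish N i) : F.TorVanish Q i := by
  have e1 : ∀ n, (F.d n).lTensor Q ∘ₗ (e.toLinearMap.rTensor _) =
      (e.toLinearMap.rTensor _) ∘ₗ (F.d n).lTensor N := fun n => by
    rw [LinearMap.lTensor_comp_rTensor, LinearMap.rTensor_comp_lTensor]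
  exact (Function.Exact.iff_of_ladder_linearEquiv (e₁ := e.rTensor _) (e₂ := e.rTensor _)
    (e₃ := e.rTensor _) (e1 _) (e1 _)).2 h

lemma mkQ_mem_smul_top_iff (p : Submodule R N) (I : Ideal R) (x : N) :
    p.mkQ x ∈ I • (⊤ : Submodule R (N ⧸ p)) ↔ x ∈ p ⊔ I • (⊤ : Submodule R N) := by
  rw [← Submodule.comap_map_mkQ, Submodule.mem_comap, Submodule.map_smul'', Submodule.map_top,
    Submodule.range_mkQ]

lemma exact_lsmul_mkQ (N : Type) [AddCommGroup N] [Module R N] (r : R) :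
    Function.Exact (LinearMap.lsmul R N r) (r • (⊤ : Submodule R N)).mkQ :=
  LinearMap.exact_lsmul_mkQ_smul_top N r

lemma ExtVanish.quotient {rs : List R} (hrs : IsWeaklyRegular N rs)
    (h : ∀ i, F.ExtVanish N i) (i : ℕ) :
    F.ExtVanish (N ⧸ Ideal.ofList rs • (⊤ : Submodule R N)) i := by
  induction rs generalizing N i with
  | nil =>
    refine (h i).of_equiv (Submodule.quotEquivOfEqBot _ (by simp)).symm
  | cons r rs ih =>
    rw [isWeaklyRegular_cons_iff] at hrs
    refine (ih (N := QuotSMulTop r N) hrs.2 (fun i => ?_) i).of_equiv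
      (Submodule.quotOfListConsSMulTopEquivQuotSMulTopInner N r rs).symm
    exact ExtVanish.of_shortExact_right (f := LinearMap.lsmul R N r) hrs.1
      (Submodule.mkQ_surjective _) (exact_lsmul_mkQ N r) (h _) (h _)

lemma TorVanish.quotient {rs : List R} (hrs : IsWeaklyRegular N rs) {s : ℕ}
    (h : ∀ i, s ≤ i → F.TorVanish N i) :
    ∃ t, ∀ i, t ≤ i → F.TorVanish (N ⧸ Ideal.ofList rs • (⊤ : Submodule R N)) i := by
  induction rs generalizing N s with
  | nil =>
    exact ⟨s, fun i hi => (h i hi).of_equiv (Submodule.quotEquivOfEqBot _ (by simp)).symm⟩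
  | cons r rs ih =>
    rw [isWeaklyRegular_cons_iff] at hrs
    obtain ⟨t, ht⟩ := ih (N := QuotSMulTop r N) hrs.2 (s := s + 1) (fun i hi => by
      obtain ⟨i, rfl⟩ : ∃ j, i = j + 1 := ⟨i - 1, by omega⟩
      exact TorVanish.of_shortExact_right (f := LinearMap.lsmul R N r) hrs.1
        (Submodule.mkQ_surjective _) (exact_lsmul_mkQ N r) (h _ (by omega)) (h _ (by omega)))
    exact ⟨t, fun i hi => (ht i hi).of_equiv
      (Submodule.quotOfListConsSMulTopEquivQuotSMulTopInner N r rs).symm⟩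

lemma Resolves.exists_desc {ε : F.X 0 →ₗ[R] M} (hF : F.Resolves ε) (u : F.X 0 →ₗ[R] N)
    (hu : ∀ x, u (F.d 0 x) = 0) : ∃ v : M →ₗ[R] N, ∀ x, v (ε x) = u x := by
  have hk : LinearMap.ker ε ≤ LinearMap.ker u := fun x hx => by
    obtain ⟨y, rfl⟩ := (hF.exact x).1 hx
    exact hu y
  refine ⟨(LinearMap.ker ε).liftQ u hk ∘ₗ (ε.quotKerEquivOfSurjective hF.surj).symm, fun x => ?_⟩
  have : (ε.quotKerEquivOfSurjective hF.surj).symm (ε x) = (LinearMap.ker ε).mkQ x := by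
    rw [LinearEquiv.symm_apply_eq]; rfl
  simp [this]

lemma Resolves.exists_lift {ε : F.X 0 →ₗ[R] M} (hF : F.Resolves ε)
    {A B C : Type} [AddCommGroup A] [AddCommGroup B] [AddCommGroup C]
    [Module R A] [Module R B] [Module R C] {f : A →ₗ[R] B} {g : B →ₗ[R] C}
    (hf : Function.Injective f) (hg : Function.Surjective g)
    (hfg : Function.Exact f g) (hA : F.ExtVanish A 0) (h : M →ₗ[R] C) :
    ∃ h' : M →ₗ[R] B, g ∘ₗ h' = h := by
  obtain ⟨u, hu⟩ := Module.projective_lifting_property g (h ∘ₗ ε) hg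
  have h1 : g ∘ₗ (u ∘ₗ F.d 0) = 0 := by
    rw [← LinearMap.comp_assoc, hu, LinearMap.comp_assoc, hF.exact.linearMap_comp_eq_zero,
      LinearMap.comp_zero]
  obtain ⟨w, hw⟩ := (compRight_exact hfg (u ∘ₗ F.d 0)).1 h1
  have hw' : ∀ x, f (w x) = u (F.d 0 x) := LinearMap.congr_fun hw
  have h2 : (F.d 1).lcomp R A w = 0 := LinearMap.ext fun x => hf <| by
    change f (w (F.d 1 x)) = f 0
    rw [hw', d_d, map_zero, map_zero]
  obtain ⟨w', hw''⟩ := (hA w).1 h2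
  obtain ⟨v, hv⟩ := hF.exists_desc (u - f ∘ₗ w') fun x => by
    have : w' (F.d 0 x) = w x := LinearMap.congr_fun hw'' x
    simp [this, hw']
  refine ⟨v, LinearMap.ext fun m => ?_⟩
  obtain ⟨x, rfl⟩ := hF.surj m
  have : g (u x) = h (ε x) := LinearMap.congr_fun hu x
  simp [hv, this, hfg.apply_apply_eq_zero]

lemma Resolves.exists_lift_quotient {ε : F.X 0 →ₗ[R] M} (hF : F.Resolves ε) {rs : List R}
    (hrs : IsWeaklyRegular N rs) (h : ∀ i, F.ExtVanish N i)
    (u : M →ₗ[R] N ⧸ Ideal.ofList rs • (⊤ : Submodule R N)) :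
    ∃ v : M →ₗ[R] N, (Submodule.mkQ _) ∘ₗ v = u := by
  induction rs generalizing N with
  | nil =>
    let e := Submodule.quotEquivOfEqBot (Ideal.ofList ([] : List R) • (⊤ : Submodule R N))
      (by rw [Ideal.ofList_nil, Submodule.bot_smul])
    refine ⟨e.toLinearMap ∘ₗ u, LinearMap.ext fun x => ?_⟩
    exact e.symm_apply_apply (u x)
  | cons r rs ih =>
    rw [isWeaklyRegular_cons_iff] at hrs
    let e := Submodule.quotOfListConsSMulTopEquivQuotSMulTopInner N r rs
    obtain ⟨v, hv⟩ := ih (N := QuotSMulTop r N) hrs.2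
      (fun i => ExtVanish.of_shortExact_right (f := LinearMap.lsmul R N r) hrs.1
        (Submodule.mkQ_surjective _) (exact_lsmul_mkQ N r) (h _) (h _)) (e.toLinearMap ∘ₗ u)
    obtain ⟨w, hw⟩ := hF.exists_lift (f := LinearMap.lsmul R N r) hrs.1
      (Submodule.mkQ_surjective _) (exact_lsmul_mkQ N r) (h 0) v
    refine ⟨w, LinearMap.ext fun x => e.injective ?_⟩
    refine Eq.trans ?_ (LinearMap.congr_fun hv x)
    rw [← hw]
    rfl

/-- A map into a module on which `rs` is weakly regular is injective as soon as it is
injective modulo `rs`. -/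
lemma injective_of_injective_mod [IsLocalRing R] [IsNoetherianRing R] [Module.Finite R M]
    {rs : List R}
    (hm : ∀ r ∈ rs, r ∈ maximalIdeal R) (hrs : IsWeaklyRegular N rs) (f : M →ₗ[R] N)
    (hf : ∀ m, f m ∈ Ideal.ofList rs • (⊤ : Submodule R N) →
      m ∈ Ideal.ofList rs • (⊤ : Submodule R M)) : Function.Injective f := by
  induction rs generalizing M N with
  | nil =>
    rw [injective_iff_map_eq_zero]
    intro m h0
    simpa using hf m (by simp [h0])
  | cons r rs ih =>
    rw [isWeaklyRegular_cons_iff] at hrs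
    let f₁ : QuotSMulTop r M →ₗ[R] QuotSMulTop r N := QuotSMulTop.map r f
    have h₁ : Function.Injective f₁ := by
      refine ih (fun s hs => hm s (List.mem_cons_of_mem _ hs)) hrs.2 f₁ fun m hm => ?_
      obtain ⟨m, rfl⟩ := Submodule.mkQ_surjective _ m
      change Submodule.mkQ _ (f m) ∈ _ at hm
      rw [mkQ_mem_smul_top_iff, ← Ideal.ofList_cons_smul] at hm ⊢
      exact hf m hm
    have hK : LinearMap.ker f ≤ maximalIdeal R • LinearMap.ker f := fun m h0 => by
      have h2 : Submodule.mkQ (r • (⊤ : Submodule R M)) m = 0 := h₁ (by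
        change Submodule.mkQ _ (f m) = f₁ 0
        rw [LinearMap.mem_ker.1 h0, map_zero, map_zero])
      rw [Submodule.mkQ_apply, Submodule.Quotient.mk_eq_zero] at h2
      obtain ⟨m', -, rfl⟩ := h2
      refine Submodule.smul_mem_smul (hm r List.mem_cons_self) (hrs.1 ?_)
      have : f (r • m') = 0 := h0
      simpa using this
    exact LinearMap.ker_eq_bot.1 (Submodule.eq_bot_of_le_smul_of_le_jacobson_bot _ _
      (IsNoetherian.noetherian _) hK (maximalIdeal_le_jacobson _))

end FreeSeq

section InjectiveHull

variable {R : Type} [CommRing R]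

lemma Submodule.exists_maximal_forall_mem {M : Type} [AddCommGroup M] [Module R M] (P : M → Prop)
    (S : Submodule R M) (hS : ∀ x ∈ S, P x) : ∃ E : Submodule R M, S ≤ E ∧ (∀ x ∈ E, P x) ∧
      ∀ E' : Submodule R M, E ≤ E' → (∀ x ∈ E', P x) → E' ≤ E := by
  obtain ⟨E, hSE, hE⟩ := zorn_le_nonempty₀ {E : Submodule R M | ∀ x ∈ E, P x}
    (fun c hc hch y hy => ⟨sSup c, fun x hx => by
      obtain ⟨z, hz, hxz⟩ := (Submodule.mem_sSup_of_directed ⟨y, hy⟩ hch.directedOn).1 hx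
      exact hc hz x hxz, fun z hz => le_sSup hz⟩) S hS
  exact ⟨E, hSE, hE.prop, fun E' h h' => hE.le_of_ge h' h⟩

lemma exists_injective_embedding (M : Type) [AddCommGroup M] [Module R M] :
    ∃ (J : Type) (_ : AddCommGroup J) (_ : Module R J) (f : M →ₗ[R] J),
      Module.Injective R J ∧ Function.Injective f := by
  let J : ModuleCat.{0} R := Injective.under (ModuleCat.of R M)
  let f : ModuleCat.of R M ⟶ J := Injective.ι _
  have hJ : Injective (ModuleCat.of R J) := Injective.injective_under _
  exact ⟨J, inferInstance, inferInstance, f.hom, (Module.injective_iff_injective_object R J).2 hJ,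
    (ModuleCat.mono_iff_injective f).1 (Injective.ι_mono _)⟩

lemma Module.Injective.of_retraction {J : Type} [AddCommGroup J] [Module R J]
    [Module.Injective R J] (E : Submodule R J) (p : J →ₗ[R] J) (hp : ∀ x, p x ∈ E)
    (hE : ∀ x ∈ E, p x = x) : Module.Injective R E where
  out X Y _ _ _ _ f hf g := by
    obtain ⟨h, hh⟩ := Module.Injective.out f hf (E.subtype ∘ₗ g)
    refine ⟨(p ∘ₗ h).codRestrict E fun y => hp (h y), fun x => Subtype.ext ?_⟩
    simp [hh, hE]

variable (R) in
/-- There is an injective module whose socle is a nonzero cyclic module. -/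
lemma exists_injective_cyclic_socle [IsLocalRing R] :
    ∃ (I : Type) (_ : AddCommGroup I) (_ : Module R I), Module.Injective R I ∧
      ∃ s : I, s ≠ 0 ∧ (∀ r ∈ maximalIdeal R, r • s = 0) ∧
        ∀ x : I, (∀ r ∈ maximalIdeal R, r • x = 0) → x ∈ Submodule.span R {s} := by
  obtain ⟨J, _, _, f, hJ, hf⟩ := exists_injective_embedding (R := R) (ResidueField R)
  set s : J := f 1 with hs
  have hs0 : s ≠ 0 := fun h => one_ne_zero (hf (h.trans f.map_zero.symm))
  have hms : ∀ r ∈ maximalIdeal R, r • s = 0 := fun r hr => by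
    rw [hs, ← map_smul, Algebra.smul_def, mul_one]
    have : algebraMap R (ResidueField R) r = 0 := (residue_eq_zero_iff r).2 hr
    rw [this, map_zero]
  obtain ⟨E, hSE, hE, hmax⟩ := Submodule.exists_maximal_forall_mem
    (fun x : J => (∀ r ∈ maximalIdeal R, r • x = 0) → x ∈ Submodule.span R {s})
    (Submodule.span R {s}) fun x hx _ => hx
  obtain ⟨C, -, hC, hCmax⟩ := Submodule.exists_maximal_forall_mem
    (fun x : J => x ∈ E → x = 0) (⊥ : Submodule R J) fun x hx _ => hx
  obtain ⟨g, hg⟩ := Module.Injective.out (C.mkQ ∘ₗ E.subtype)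
    ((injective_iff_map_eq_zero _).2 fun x hx => Subtype.ext <|
      hC x ((Submodule.Quotient.mk_eq_zero C).1 hx) x.2) E.subtype
  let p : J →ₗ[R] J := g ∘ₗ C.mkQ
  have hpE : ∀ x ∈ E, p x = x := fun x hx => hg ⟨x, hx⟩
  have hpC : ∀ x ∈ C, p x = 0 := fun x hx => by
    have : C.mkQ x = 0 := (Submodule.Quotient.mk_eq_zero C).2 hx
    change g (C.mkQ x) = 0
    rw [this, map_zero]
  have hker : LinearMap.ker p ≤ C := hCmax _ hpC fun x hx hxE => (hpE x hxE).symm.trans hx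
  have hrange : LinearMap.range p ≤ E := by
    refine hmax _ (fun x hx => ⟨x, hpE x hx⟩) ?_
    rintro _ ⟨j, rfl⟩ hj
    by_cases hjC : j ∈ C
    · rw [hpC j hjC]; exact zero_mem _
    obtain ⟨x, hx, hxE, hx0⟩ : ∃ x ∈ C ⊔ Submodule.span R {j}, x ∈ E ∧ x ≠ 0 := by
      by_contra! h
      exact hjC <| hCmax _ le_sup_left h <|
        le_sup_right (a := C) (Submodule.mem_span_singleton_self j)
    obtain ⟨c, hc, y, hy, rfl⟩ := Submodule.mem_sup.1 hx
    obtain ⟨r, rfl⟩ := Submodule.mem_span_singleton.1 hy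
    have h1 : c + r • j = r • p j := by
      conv_lhs => rw [← hpE _ hxE]
      rw [map_add, map_smul, hpC c hc, zero_add]
    have hr : IsUnit r := by
      by_contra hr
      exact hx0 (h1.trans (hj r hr))
    refine hE _ ?_ hj
    rw [h1] at hxE
    exact (Submodule.smul_mem_iff_of_isUnit E hr).1 hxE
  refine ⟨E, inferInstance, inferInstance,
    Module.Injective.of_retraction E p (fun x => hrange ⟨x, rfl⟩) hpE,
    ⟨s, hSE (Submodule.mem_span_singleton_self s)⟩, fun h => hs0 (congrArg Subtype.val h),
    fun r hr => Subtype.ext (hms r hr), fun x hx => ?_⟩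
  obtain ⟨a, ha⟩ := Submodule.mem_span_singleton.1
    (hE x x.2 fun r hr => congrArg Subtype.val (hx r hr))
  exact Submodule.mem_span_singleton.2 ⟨a, Subtype.ext ha⟩

end InjectiveHull

section Matlis

open scoped TensorProduct

variable {R : Type} [CommRing R]

lemma isNoetherian_torsionBySet_pow [IsNoetherianRing R] {I : Type} [AddCommGroup I] [Module R I]
    (J : Ideal R) (hJ : IsNoetherian R (Submodule.torsionBySet R I J)) (n : ℕ) :
    IsNoetherian R (Submodule.torsionBySet R I (J ^ n : Ideal R)) := by
  induction n with
  | zero =>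
    have : Submodule.torsionBySet R I ((J ^ 0 : Ideal R) : Set R) = ⊥ := by
      rw [pow_zero, Ideal.one_eq_top, eq_bot_iff]
      intro x hx
      simpa using (Submodule.mem_torsionBySet_iff _ _).1 hx ⟨1, trivial⟩
    rw [this]
    infer_instance
  | succ n ih =>
    obtain ⟨t, ht⟩ := IsNoetherian.noetherian (R := R) J
    have hmul : ∀ x : t, ∀ y ∈ Submodule.torsionBySet R I ((J ^ (n + 1) : Ideal R) : Set R),
        LinearMap.lsmul R I x y ∈ Submodule.torsionBySet R I ((J ^ n : Ideal R) : Set R) := by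
      intro x y hy
      rw [Submodule.mem_torsionBySet_iff] at hy ⊢
      rintro ⟨a, ha⟩
      have hx : (x : R) ∈ J := ht ▸ Submodule.subset_span x.2
      have := hy ⟨a * x, by rw [pow_succ]; exact Ideal.mul_mem_mul ha hx⟩
      simpa [mul_smul] using this
    let g := LinearMap.pi fun x : t => (LinearMap.lsmul R I (x : R)).restrict (hmul x)
    have hg : ∀ y ∈ LinearMap.ker g, (y : I) ∈ Submodule.torsionBySet R I (J : Set R) := by
      intro y hy
      have h1 : J ≤ LinearMap.ker (LinearMap.toSpanSingleton R I (y : I)) := by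
        refine ht.ge.trans (Submodule.span_le.2 fun x hx => ?_)
        exact congrArg Subtype.val (congrFun (LinearMap.mem_ker.1 hy) ⟨x, hx⟩)
      rw [Submodule.mem_torsionBySet_iff]
      exact fun a => h1 a.2
    have : IsNoetherian R (LinearMap.ker g) :=
      isNoetherian_of_injective
        ((Submodule.subtype _ ∘ₗ (LinearMap.ker g).subtype).codRestrict _ fun y => hg y y.2)
        ((LinearMap.injective_codRestrict_iff _).2
          (Subtype.val_injective.comp Subtype.val_injective))
    exact isNoetherian_of_range_eq_ker (LinearMap.ker g).subtype g (Submodule.range_subtype _)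

lemma finite_linearMap_of_isNoetherian_torsionBySet {I A : Type} [AddCommGroup I]
    [Module R I] [AddCommGroup A] [Module R A] [Module.Finite R A] (J : Ideal R)
    (hJ : IsNoetherian R (Submodule.torsionBySet R I J))
    (hA : ∀ r ∈ J, ∀ a : A, r • a = 0) : Module.Finite R (A →ₗ[R] I) := by
  obtain ⟨n, a, ha⟩ := Module.Finite.exists_fin (R := R) (M := A)
  have h : ∀ (φ : A →ₗ[R] I) i, φ (a i) ∈ Submodule.torsionBySet R I (J : Set R) := fun φ i => by
    rw [Submodule.mem_torsionBySet_iff]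
    intro r
    rw [← map_smul]
    exact (congrArg φ (hA r r.2 _)).trans φ.map_zero
  let g : (A →ₗ[R] I) →ₗ[R] (Fin n → Submodule.torsionBySet R I (J : Set R)) :=
    LinearMap.pi fun i => (LinearMap.applyₗ (a i)).codRestrict _ fun φ => h φ i
  refine Module.Finite.of_injective g fun φ ψ hφ => LinearMap.ext_on_range ha fun i => ?_
  exact congrArg Subtype.val (congrFun hφ i)

variable {I : Type} [AddCommGroup I] [Module R I] [Module.Injective R I]

lemma Module.Injective.exists_extend {Y Z : Type} [AddCommGroup Y] [AddCommGroup Z]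
    [Module R Y] [Module R Z] (v : Y →ₗ[R] Z) (ψ : Y →ₗ[R] I)
    (h : LinearMap.ker v ≤ LinearMap.ker ψ) : ∃ φ : Z →ₗ[R] I, φ ∘ₗ v = ψ := by
  obtain ⟨φ, hφ⟩ := Module.Injective.out ((LinearMap.ker v).liftQ v le_rfl)
    (LinearMap.ker_eq_bot.1 (Submodule.ker_liftQ_eq_bot _ _ _ le_rfl))
    ((LinearMap.ker v).liftQ ψ h)
  exact ⟨φ, LinearMap.ext fun y => hφ (Submodule.Quotient.mk y)⟩

lemma Module.Injective.exact_lcomp {X Y Z : Type} [AddCommGroup X] [AddCommGroup Y]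
    [AddCommGroup Z] [Module R X] [Module R Y] [Module R Z] {u : X →ₗ[R] Y} {v : Y →ₗ[R] Z}
    (huv : Function.Exact u v) : Function.Exact (v.lcomp R I) (u.lcomp R I) := by
  intro ψ
  refine ⟨fun hψ => Module.Injective.exists_extend v ψ fun y hy => ?_, ?_⟩
  · obtain ⟨x, rfl⟩ := (huv y).1 hy
    exact LinearMap.congr_fun hψ x
  · rintro ⟨φ, rfl⟩
    exact LinearMap.ext fun x => by simp [huv.apply_apply_eq_zero]

lemma exists_linearMap_apply_ne_zero [IsLocalRing R] {s : I} (hs : s ≠ 0)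
    (hms : ∀ r ∈ maximalIdeal R, r • s = 0) {A : Type} [AddCommGroup A] [Module R A] {a : A}
    (ha : a ≠ 0) : ∃ φ : A →ₗ[R] I, φ a ≠ 0 := by
  obtain ⟨φ, hφ⟩ := Module.Injective.exists_extend (LinearMap.toSpanSingleton R A a)
    (LinearMap.toSpanSingleton R I s) fun r hr => hms r fun hu => ha <| by
      rw [LinearMap.mem_ker, LinearMap.toSpanSingleton_apply] at hr
      exact (hu.smul_eq_zero).1 hr
  refine ⟨φ, ?_⟩
  have : φ ((1 : R) • a) = (1 : R) • s := LinearMap.congr_fun hφ 1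
  rw [one_smul, one_smul] at this
  rwa [this]

/-- The natural map `Hom(A, I) ⊗ P → Hom(Hom(P, A), I)`. -/
def tensorToHomHom (A I P : Type) [AddCommGroup A] [AddCommGroup I] [AddCommGroup P]
    [Module R A] [Module R I] [Module R P] :
    (A →ₗ[R] I) ⊗[R] P →ₗ[R] ((P →ₗ[R] A) →ₗ[R] I) :=
  TensorProduct.lift ((LinearMap.llcomp R (P →ₗ[R] A) A I).compl₂ LinearMap.applyₗ)

section

variable (A I P Q : Type) [AddCommGroup A] [AddCommGroup I] [AddCommGroup P] [AddCommGroup Q]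
    [Module R A] [Module R I] [Module R P] [Module R Q]

@[simp]
lemma tensorToHomHom_tmul (φ : A →ₗ[R] I) (f : P) (h : P →ₗ[R] A) :
    tensorToHomHom A I P (φ ⊗ₜ f) h = φ (h f) := rfl

lemma tensorToHomHom_lTensor (d : P →ₗ[R] Q) :
    tensorToHomHom A I Q ∘ₗ d.lTensor (A →ₗ[R] I) =
      (d.lcomp R A).lcomp R I ∘ₗ tensorToHomHom A I P :=
  TensorProduct.ext' fun φ f => LinearMap.ext fun h => by simp

lemma tensorToHomHom_bijective (k : ℕ) :
    Function.Bijective (tensorToHomHom (R := R) A I (Fin k → R)) := by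
  let c (i : Fin k) : A →ₗ[R] (Fin k → R) →ₗ[R] A :=
    (LinearMap.lsmul R A).flip.compl₂ (LinearMap.proj i)
  let e := TensorProduct.piScalarRight R R (A →ₗ[R] I) (Fin k)
  have hc : ∀ z i a, tensorToHomHom A I (Fin k → R) z (c i a) = e z i a := fun z i a => by
    induction z with
    | zero => simp
    | tmul φ f => simp [c, e]
    | add x y hx hy => simp [hx, hy]
  have hsum : ∀ h : (Fin k → R) →ₗ[R] A, h = ∑ i, c i (h (Pi.single i 1)) := fun h =>
    LinearMap.pi_ext' fun i => LinearMap.ext_ring <| by simp [c, Pi.single_apply]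
  constructor
  · rw [injective_iff_map_eq_zero]
    intro z hz
    rw [← e.map_eq_zero_iff]
    funext i
    ext a
    rw [← hc, hz]
    rfl
  · intro ψ
    refine ⟨e.symm fun i => ψ ∘ₗ c i, LinearMap.ext fun h => ?_⟩
    rw [hsum h, map_sum, map_sum]
    simp [hc]

end

namespace FreeSeq

variable {F : FreeSeq R} {A M : Type} [AddCommGroup A] [Module R A] [AddCommGroup M] [Module R M]

lemma ExtVanish.torVanish_hom {i : ℕ} (h : F.ExtVanish A i) : F.TorVanish (A →ₗ[R] I) i := by
  let e (n : ℕ) := LinearEquiv.ofBijective (tensorToHomHom A I (F.X n))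
    (tensorToHomHom_bijective A I (F.k n))
  exact (Function.Exact.iff_of_ladder_linearEquiv (e₁ := e _) (e₂ := e _) (e₃ := e _)
    (tensorToHomHom_lTensor A I _ _ (F.d (i + 1))).symm
    (tensorToHomHom_lTensor A I _ _ (F.d i)).symm).1 (Module.Injective.exact_lcomp h)

lemma Resolves.exists_lTensor_eq_tmul {ε : F.X 0 →ₗ[R] M} (hF : F.Resolves ε) (f : F.X 0)
    (hf : ∀ h : M →ₗ[R] A, h (ε f) = 0) (φ : A →ₗ[R] I) :
    ∃ z, (F.d 0).lTensor (A →ₗ[R] I) z = φ ⊗ₜ f := by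
  obtain ⟨ψ, hψ⟩ := Module.Injective.exists_extend ((F.d 0).lcomp R A)
    (tensorToHomHom A I (F.X 0) (φ ⊗ₜ f)) fun h hh => by
      obtain ⟨v, hv⟩ := hF.exists_desc h (LinearMap.congr_fun (LinearMap.mem_ker.1 hh))
      rw [LinearMap.mem_ker, tensorToHomHom_tmul, ← hv, hf, map_zero]
  obtain ⟨z, rfl⟩ := (tensorToHomHom_bijective A I (F.k 1)).2 ψ
  refine ⟨z, (tensorToHomHom_bijective A I (F.k 0)).1 ?_⟩
  exact (LinearMap.congr_fun (tensorToHomHom_lTensor A I _ _ (F.d 0)) z).trans hψ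

end FreeSeq

end Matlis

section Depth

open scoped TensorProduct
open RingTheory.Sequence

variable {R : Type} [CommRing R] [IsLocalRing R] {M : Type} [AddCommGroup M] [Module R M]

lemma rdepth_eq_zero [Nontrivial M] {n : ℕ}
    (h : ∀ r ∈ maximalIdeal R ^ n, ∀ x : M, r • x = 0) : rdepth R M = 0 := by
  rw [rdepth, if_neg (not_subsingleton M)]
  refine le_antisymm (sSup_le ?_) (zero_le)
  rintro _ ⟨rs, rfl, hm, hrs⟩
  cases rs with
  | nil => simp
  | cons r rs =>
    exfalso
    obtain ⟨x, hx⟩ := exists_ne (0 : M)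
    refine hx (((isRegular_cons_iff M r rs).1 hrs).1.pow n ?_)
    change r ^ n • x = r ^ n • (0 : M)
    rw [h _ (Ideal.pow_mem_pow (hm r List.mem_cons_self) n), smul_zero]

lemma exists_isSMulRegular_of_one_le_rdepth (h : 1 ≤ rdepth R M) :
    ∃ r ∈ maximalIdeal R, IsSMulRegular M r := by
  by_cases hM : Subsingleton M
  · exact ⟨0, zero_mem _, fun _ _ _ => Subsingleton.elim _ _⟩
  by_contra! hr
  rw [rdepth, if_neg hM] at h
  refine one_ne_zero (le_antisymm (h.trans (sSup_le ?_)) zero_le)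
  rintro _ ⟨rs, rfl, hm, hrs⟩
  cases rs with
  | nil => simp
  | cons r rs =>
    exact (hr r (hm r List.mem_cons_self) ((isRegular_cons_iff M r rs).1 hrs).1).elim

lemma one_le_rdepth [Module.Finite R M] {r : R} (hr : r ∈ maximalIdeal R)
    (h : IsSMulRegular M r) : 1 ≤ rdepth R M := by
  by_cases hM : Subsingleton M
  · rw [rdepth, if_pos hM]; exact le_top
  have := not_subsingleton_iff_nontrivial.1 hM
  have hm : ∀ s ∈ [r], s ∈ maximalIdeal R := by simpa using hr
  rw [rdepth, if_neg hM]
  refine le_sSup ⟨[r], by simp, hm, ?_⟩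
  rw [isRegular_iff_isWeaklyRegular_of_subset_maximalIdeal hm, isWeaklyRegular_cons_iff]
  exact ⟨h, IsWeaklyRegular.nil R _⟩

lemma nontrivial_tensorProduct {L : Type} [AddCommGroup L] [Module R L] [Module.Finite R L]
    [Module.Finite R M] [Nontrivial L] [Nontrivial M] : Nontrivial (L ⊗[R] M) := by
  obtain ⟨g, hg⟩ : ∃ g : L →ₗ[R] ResidueField R, Function.Surjective g := by
    have : Nontrivial (ResidueField R ⊗[R] L) := by
      rw [← not_subsingleton_iff_nontrivial, subsingleton_tensorProduct]
      exact not_subsingleton L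
    obtain ⟨x, hx⟩ := exists_ne (0 : ResidueField R ⊗[R] L)
    obtain ⟨φ, hφ⟩ : ∃ φ : Module.Dual (ResidueField R) (ResidueField R ⊗[R] L), φ x ≠ 0 := by
      by_contra! h
      exact hx ((Module.forall_dual_apply_eq_zero_iff _ x).1 h)
    let g : L →ₗ[R] ResidueField R :=
      φ.restrictScalars R ∘ₗ TensorProduct.mk R (ResidueField R) L 1
    have h1 : ∀ a l, φ (a ⊗ₜ l) = a * g l := fun a l => by
      have : a ⊗ₜ[R] l = a • ((1 : ResidueField R) ⊗ₜ[R] l) := by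
        rw [TensorProduct.smul_tmul', smul_eq_mul, mul_one]
      rw [this, map_smul, smul_eq_mul]
      rfl
    obtain ⟨l, hl⟩ : ∃ l, g l ≠ 0 := by
      by_contra! h
      have h0 : ∀ y, φ y = 0 := fun y => by
        induction y with
        | zero => exact map_zero φ
        | tmul a l => rw [h1, h, mul_zero]
        | add y z hy hz => rw [map_add, hy, hz, add_zero]
      exact hφ (h0 x)
    refine ⟨g, fun y => ?_⟩
    obtain ⟨r, hr⟩ := residue_surjective (y / g l)
    refine ⟨r • l, ?_⟩
    rw [map_smul, Algebra.smul_def]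
    exact (congrArg (· * g l) hr).trans (div_mul_cancel₀ y hl)
  have := not_subsingleton M
  rw [← subsingleton_tensorProduct (R := R), not_subsingleton_iff_nontrivial] at this
  exact (LinearMap.rTensor_surjective M hg).nontrivial

variable [IsNoetherianRing R]

variable (R) in
lemma exists_isRegular_of_isCohenMacaulay (hCM : IsCohenMacaulayLocalRing R)
    (hdim : 0 < ringKrullDim R) : ∃ rs : List R, rs ≠ [] ∧ (∀ r ∈ rs, r ∈ maximalIdeal R) ∧
      IsRegular R rs ∧ rdepth R R = rs.length ∧ ∃ n, maximalIdeal R ^ n ≤ Ideal.ofList rs := by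
  have hlt : rdepth R R < ⊤ := by
    have := ringKrullDim_lt_top (R := R)
    rw [← hCM] at this
    exact WithBot.coe_lt_coe.1 this
  obtain ⟨rs, hlen, hm, hrs⟩ : ∃ rs : List R, (rs.length : ℕ∞) = rdepth R R ∧
      (∀ r ∈ rs, r ∈ maximalIdeal R) ∧ IsRegular R rs := by
    rw [rdepth, if_neg (not_subsingleton R)] at hlt ⊢
    have : Nonempty {n : ℕ∞ | ∃ rs : List R, (rs.length : ℕ∞) = n ∧
      (∀ r ∈ rs, r ∈ maximalIdeal R) ∧ IsRegular R rs} :=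
      ⟨_, [], rfl, by simp, IsRegular.nil R R⟩
    exact ENat.sSup_mem_of_nonempty_of_lt_top hlt
  refine ⟨rs, ?_, hm, hrs, hlen.symm, ?_⟩
  · rintro rfl
    rw [IsCohenMacaulayLocalRing, ← hlen] at hCM
    simp [← hCM] at hdim
  · have hd := ringKrullDim_add_length_eq_ringKrullDim_of_isRegular rs hrs
    rw [← hCM, ← hlen] at hd
    have hd0 : ringKrullDim (R ⧸ Ideal.ofList rs) ≤ 0 := by
      rw [← ENat.WithBot.add_le_add_natCast_right_iff (c := rs.length), zero_add]
      exact hd.le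
    have := Ring.krullDimLE_zero_iff.1 (Ring.krullDimLE_iff.2 hd0)
    refine Ideal.exists_pow_le_of_le_radical_of_fg ?_ (IsNoetherian.noetherian _)
    rw [Ideal.radical_eq_sInf]
    refine le_sInf fun P hP => ?_
    obtain ⟨hJP, hP⟩ := hP
    have hmap := this (P.map (Ideal.Quotient.mk _))
      (Ideal.map_isPrime_of_surjective Ideal.Quotient.mk_surjective (by simpa using hJP))
    have := Ideal.comap_isMaximal_of_surjective (Ideal.Quotient.mk (Ideal.ofList rs))
      Ideal.Quotient.mk_surjective (K := P.map (Ideal.Quotient.mk _))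
    rw [Ideal.comap_map_mk hJP] at this
    exact (eq_maximalIdeal this).ge

end Depth

section KilledByPower

open scoped TensorProduct

variable {R : Type} [CommRing R] {J : Ideal R} {L P : Type} [AddCommGroup L] [AddCommGroup P]
  [Module R L] [Module R P]

lemma smul_tensorProduct_eq_zero {r : R} (h : ∀ x : L, r • x = 0) (z : L ⊗[R] P) : r • z = 0 := by
  induction z with
  | zero => exact smul_zero r
  | tmul x y => rw [TensorProduct.smul_tmul', h, TensorProduct.zero_tmul]
  | add x y hx hy => rw [smul_add, hx, hy, add_zero]

lemma smul_quotient_eq_zero {r : R} (hr : r ∈ J) (a : R ⧸ J) : r • a = 0 := by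
  obtain ⟨a, rfl⟩ := Submodule.mkQ_surjective J a
  rw [← map_smul]
  exact (Submodule.Quotient.mk_eq_zero J).2 (J.mul_mem_right a hr)

end KilledByPower

/-- A regular sequence in the maximal ideal witnessing that a local ring is Cohen-Macaulay of
positive dimension. -/
structure IsParameterSequence {R : Type} [CommRing R] [IsLocalRing R] (rs : List R) : Prop where
  ne_nil : rs ≠ []
  mem : ∀ r ∈ rs, r ∈ maximalIdeal R
  regular : RingTheory.Sequence.IsRegular R rs
  rdepth_eq : rdepth R R = rs.length
  exists_pow_le : ∃ n, maximalIdeal R ^ n ≤ Ideal.ofList rs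

namespace FreeSeq

open scoped TensorProduct

variable {R : Type} [CommRing R]

/-- `F` resolves `M` through `ε`, and its dual is exact in positive degrees. -/
structure StronglyResolves (F : FreeSeq R) {M : Type} [AddCommGroup M] [Module R M]
    (ε : F.X 0 →ₗ[R] M) : Prop extends F.Resolves ε where
  extVanish : ∀ i, F.ExtVanish R i

variable {F : FreeSeq R} {M : Type} [AddCommGroup M] [Module R M] {ε : F.X 0 →ₗ[R] M}

lemma StronglyResolves.shift (h : F.StronglyResolves ε) :
    F.shift.StronglyResolves (LinearMap.range (F.shift.d 0)).mkQ where
  surj := Submodule.mkQ_surjective _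
  exact := LinearMap.exact_map_mkQ_range _
  extVanish i := h.extVanish (i + 1)

lemma TorVanish.zero_of_isSMulRegular (hF : F.Resolves ε) {B L : Type} [AddCommGroup B]
    [AddCommGroup L] [Module R B] [Module R L] [Module.Flat R B] {p : B →ₗ[R] L}
    (hp : Function.Surjective p) {r : R} (hr : ∀ x : L, r • x = 0)
    (hreg : IsSMulRegular (LinearMap.ker p ⊗[R] M) r) : F.TorVanish L 0 := by
  let j := (LinearMap.ker p).subtype
  have hj : Function.Exact j p := fun x => by simp [j]
  have hrT (n) := rTensor_exact (F.X n) hj hp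
  intro z
  refine ⟨fun hz => ?_, ?_⟩
  swap
  · rintro ⟨u, rfl⟩
    exact F.lTensor_d_d L 0 u
  obtain ⟨z', rfl⟩ := LinearMap.rTensor_surjective _ hp z
  rw [lTensor_rTensor_comm] at hz
  obtain ⟨w, hw⟩ := (hrT 0 _).1 hz
  obtain ⟨v, hv⟩ := (hrT 1 (r • z')).1 (by rw [map_smul, smul_tensorProduct_eq_zero hr])
  have hdv : (F.d 0).lTensor _ v = r • w := by
    refine Module.Flat.rTensor_preserves_injective_linearMap (M := F.X 0) j
      (Submodule.subtype_injective _) ?_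
    rw [← lTensor_rTensor_comm, hv, map_smul, map_smul, hw]
  have hε := lTensor_exact (LinearMap.ker p) hF.exact hF.surj
  obtain ⟨v', rfl⟩ := (hε w).1 <| hreg <| by
    change r • _ = r • _
    rw [smul_zero, ← map_smul, ← hdv, hε.apply_apply_eq_zero]
  obtain ⟨u, hu⟩ := (torVanish_of_flat (F := F) (A := B) 0 (z' - j.rTensor _ v')).1 (by
    rw [map_sub, lTensor_rTensor_comm, hw, sub_self])
  refine ⟨p.rTensor _ u, ?_⟩
  rw [lTensor_rTensor_comm, hu, map_sub, (hrT 1).apply_apply_eq_zero, sub_zero]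

variable [IsLocalRing R] {rs : List R}

lemma StronglyResolves.extVanish_quotient (h : F.StronglyResolves ε) (hrs : IsParameterSequence rs)
    (i : ℕ) : F.ExtVanish (R ⧸ Ideal.ofList rs) i :=
  (ExtVanish.quotient hrs.regular.toIsWeaklyRegular h.extVanish i).of_equiv
    (Submodule.quotEquivOfEq _ _ (by simp))

variable [IsNoetherianRing R] [Module.Finite R M]

/-- There is an injective module `I` that separates points and such that `Hom(A, I)` is finite for
finite modules `A` killed by a power of the maximal ideal. -/
lemma _root_.exists_injective_finite_hom (R : Type) [CommRing R] [IsLocalRing R]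
    [IsNoetherianRing R] : ∃ (I : Type) (_ : AddCommGroup I) (_ : Module R I),
      Module.Injective R I ∧
      (∀ (A : Type) [AddCommGroup A] [Module R A] (a : A), a ≠ 0 → ∃ φ : A →ₗ[R] I, φ a ≠ 0) ∧
      ∀ (A : Type) [AddCommGroup A] [Module R A] [Module.Finite R A] (n : ℕ),
        (∀ r ∈ maximalIdeal R ^ n, ∀ a : A, r • a = 0) → Module.Finite R (A →ₗ[R] I) := by
  obtain ⟨I, _, _, hI, s, hs, hms, hsoc⟩ := exists_injective_cyclic_socle R
  refine ⟨I, _, _, hI, fun A _ _ a ha => exists_linearMap_apply_ne_zero hs hms ha,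
    fun A _ _ _ n hA => finite_linearMap_of_isNoetherian_torsionBySet (maximalIdeal R ^ n)
      (isNoetherian_torsionBySet_pow _ ?_ n) hA⟩
  have : IsNoetherian R (Submodule.span R {s}) :=
    isNoetherian_span_of_finite R (Set.finite_singleton s)
  exact isNoetherian_of_le fun x hx => hsoc x fun r hr =>
    (Submodule.mem_torsionBySet_iff _ _).1 hx ⟨r, hr⟩

lemma StronglyResolves.rdepth_eq (h : F.StronglyResolves ε) (hdep : PropDep R)
    (hrs : IsParameterSequence rs) [Nontrivial M] : rdepth R M = rdepth R R := by
  obtain ⟨n, hn⟩ := hrs.exists_pow_le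
  obtain ⟨I, _, _, hI, hsep, hfin⟩ := exists_injective_finite_hom R
  let A := R ⧸ Ideal.ofList rs
  have hA : ∀ r ∈ maximalIdeal R ^ n, ∀ a : A, r • a = 0 := fun r hr =>
    smul_quotient_eq_zero (hn hr)
  have hE : ∀ r ∈ maximalIdeal R ^ n, ∀ φ : A →ₗ[R] I, r • φ = 0 := fun r hr φ =>
    LinearMap.ext fun a => by
      rw [LinearMap.smul_apply, ← map_smul, hA r hr, map_zero, LinearMap.zero_apply]
  have hJ : Ideal.ofList rs ≠ ⊤ := fun hJ => hrs.regular.top_ne_smul (by simp [hJ])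
  have : Nontrivial A := Ideal.Quotient.nontrivial_iff.2 hJ
  have := hfin A n hA
  have : Nontrivial (A →ₗ[R] I) := by
    obtain ⟨φ, hφ⟩ := hsep A 1 one_ne_zero
    exact ⟨φ, 0, fun h => hφ (by rw [h, LinearMap.zero_apply])⟩
  have := nontrivial_tensorProduct (R := R) (L := A →ₗ[R] I) (M := M)
  have key := hdep (A →ₗ[R] I) M inferInstance inferInstance inferInstance inferInstance
    fun i hi => by
      obtain ⟨i, rfl⟩ := Nat.exists_eq_succ_of_ne_zero hi.ne'
      exact (h.subsingleton_torGroup_iff _ i).2 (h.extVanish_quotient hrs i).torVanish_hom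
  rwa [rdepth_eq_zero (n := n) hE, rdepth_eq_zero (n := n) fun r hr =>
    smul_tensorProduct_eq_zero (hE r hr), zero_add, zero_add, eq_comm] at key

lemma StronglyResolves.torVanish_zero (h : F.StronglyResolves ε) (hdep : PropDep R)
    (hrs : IsParameterSequence rs) {L : Type} [AddCommGroup L] [Module R L] [Module.Finite R L]
    {n : ℕ} (hL : ∀ r ∈ maximalIdeal R ^ n, ∀ x : L, r • x = 0)
    (hT : ∀ i, F.TorVanish L (i + 1)) : F.TorVanish L 0 := by
  obtain ⟨b, p, hp⟩ := exists_finite_cover (R := R) L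
  have hT' : ∀ i, F.TorVanish (LinearMap.ker p) i := fun i =>
    TorVanish.of_shortExact_left (Submodule.subtype_injective _) hp (fun x => by simp)
      (torVanish_of_flat i) (hT i)
  obtain ⟨r, hr, hreg⟩ : ∃ r ∈ maximalIdeal R, IsSMulRegular (LinearMap.ker p ⊗[R] M) r := by
    rcases subsingleton_or_nontrivial M with hM | hM
    · exact ⟨0, zero_mem _, fun _ _ _ => Subsingleton.elim _ _⟩
    rcases subsingleton_or_nontrivial (LinearMap.ker p) with hK | hK
    · exact ⟨0, zero_mem _, fun _ _ _ => Subsingleton.elim _ _⟩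
    have key := hdep (LinearMap.ker p) M inferInstance inferInstance inferInstance inferInstance
      fun i hi => by
        obtain ⟨i, rfl⟩ := Nat.exists_eq_succ_of_ne_zero hi.ne'
        exact (h.subsingleton_torGroup_iff _ i).2 (hT' i)
    rw [h.rdepth_eq hdep hrs] at key
    refine exists_isSMulRegular_of_one_le_rdepth (M := LinearMap.ker p ⊗[R] M) ?_
    obtain ⟨r, l, rfl⟩ := List.exists_cons_of_ne_nil hrs.ne_nil
    have hr := ((RingTheory.Sequence.isRegular_cons_iff R r l).1 hrs.regular).1
    rw [WithTop.add_right_cancel (by rw [hrs.rdepth_eq]; exact ENat.natCast_ne_top _) key]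
    refine one_le_rdepth (hrs.mem r List.mem_cons_self) fun x y hxy => Subtype.ext ?_
    funext i
    exact hr (congrFun (congrArg Subtype.val hxy) i)
  exact TorVanish.zero_of_isSMulRegular h.toResolves hp (hL _ (Ideal.pow_mem_pow hr n)) (hreg.pow n)

lemma StronglyResolves.torVanish_of_eventually (h : F.StronglyResolves ε) (hdep : PropDep R)
    (hrs : IsParameterSequence rs) {L : Type} [AddCommGroup L] [Module R L] [Module.Finite R L]
    {n : ℕ} (hL : ∀ r ∈ maximalIdeal R ^ n, ∀ x : L, r • x = 0) {t : ℕ}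
    (hT : ∀ i, t ≤ i → F.TorVanish L i) (i : ℕ) : F.TorVanish L i := by
  induction t generalizing F M i with
  | zero => exact hT i (Nat.zero_le i)
  | succ t ih =>
    have hs : ∀ i, F.TorVanish L (i + 1) := fun i =>
      ih h.shift (fun i hi => hT (i + 1) (Nat.succ_le_succ hi)) i
    cases i with
    | zero => exact h.torVanish_zero hdep hrs hL hs
    | succ i => exact hs i

lemma StronglyResolves.mem_smul_top (h : F.StronglyResolves ε) (hdep : PropDep R)
    (hrs : IsParameterSequence rs) {m : M} (hm : ∀ u : M →ₗ[R] R ⧸ Ideal.ofList rs, u m = 0) :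
    m ∈ Ideal.ofList rs • (⊤ : Submodule R M) := by
  obtain ⟨n, hn⟩ := hrs.exists_pow_le
  obtain ⟨I, _, _, hI, hsep, hfin⟩ := exists_injective_finite_hom R
  let A := R ⧸ Ideal.ofList rs
  have hA : ∀ r ∈ maximalIdeal R ^ n, ∀ a : A, r • a = 0 := fun r hr =>
    smul_quotient_eq_zero (hn hr)
  have := hfin A n hA
  obtain ⟨k, φ, hφ⟩ := Module.Finite.exists_fin (R := R) (M := A →ₗ[R] I)
  let E := A →ₗ[R] (Fin k → I)
  have hE : ∀ r ∈ maximalIdeal R ^ n, ∀ φ : E, r • φ = 0 := fun r hr φ =>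
    LinearMap.ext fun a => by
      rw [LinearMap.smul_apply, ← map_smul, hA r hr, map_zero, LinearMap.zero_apply]
  have : Module.Finite R E :=
    Module.Finite.of_injective
      (LinearMap.pi fun i => LinearMap.compRight R (LinearMap.proj (φ := fun _ => I) i) :
        E →ₗ[R] (Fin k → (A →ₗ[R] I)))
      fun _ _ h => LinearMap.ext fun a => funext fun i => LinearMap.congr_fun (congrFun h i) a
  let inc : A →ₗ[R] E := LinearMap.compRight R (LinearMap.pi φ) ∘ₗ LinearMap.mul R A
  have hinc : Function.Injective inc := by
    rw [injective_iff_map_eq_zero]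
    intro a ha
    by_contra ha0
    obtain ⟨ψ, hψ⟩ := hsep A a ha0
    have hle : ⊤ ≤ LinearMap.ker (LinearMap.applyₗ (R := R) (M₂ := I) a) := by
      rw [← hφ, Submodule.span_le]
      rintro _ ⟨i, rfl⟩
      have : φ i (a * 1) = 0 := congrFun (LinearMap.congr_fun ha 1) i
      rwa [mul_one] at this
    exact hψ (hle (x := ψ) trivial)
  have hAT : ∀ i, F.TorVanish A i := by
    obtain ⟨t, ht⟩ := TorVanish.quotient (F := F) (N := R) hrs.regular.toIsWeaklyRegular (s := 0)
      fun i _ => torVanish_of_flat i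
    exact h.torVanish_of_eventually hdep hrs hA fun i hi => (ht i hi).of_equiv
      (Submodule.quotEquivOfEq _ _ (by simp))
  have hET : ∀ i, F.TorVanish E i := fun i => (h.extVanish_quotient hrs i).torVanish_hom
  let p := (LinearMap.range inc).mkQ
  have hp : Function.Surjective p := Submodule.mkQ_surjective _
  have hinp : Function.Exact inc p := LinearMap.exact_map_mkQ_range inc
  have hLT : F.TorVanish (E ⧸ LinearMap.range inc) 0 :=
    h.torVanish_zero hdep hrs (n := n) (fun r hr x => by
      obtain ⟨x, rfl⟩ := hp x
      rw [← map_smul, hE r hr, map_zero]) fun i =>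
        TorVanish.of_shortExact_right hinc hp hinp (hAT i) (hET (i + 1))
  obtain ⟨f, rfl⟩ := h.surj m
  obtain ⟨z, hz⟩ := h.exists_lTensor_eq_tmul f hm (inc 1)
  obtain ⟨u, hu⟩ := (hLT (p.rTensor _ z)).1 (by
    rw [lTensor_rTensor_comm, hz, LinearMap.rTensor_tmul, hinp.apply_apply_eq_zero,
      TensorProduct.zero_tmul])
  obtain ⟨u, rfl⟩ := LinearMap.rTensor_surjective _ hp u
  rw [lTensor_rTensor_comm] at hu
  obtain ⟨w, hw⟩ := (rTensor_exact (F.X 1) hinp hp (z - (F.d 1).lTensor _ u)).1 (by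
    rw [map_sub, hu, sub_self])
  have hd : (F.d 0).lTensor A w = 1 ⊗ₜ f := by
    refine Module.Flat.rTensor_preserves_injective_linearMap (M := F.X 0) inc hinc ?_
    rw [← lTensor_rTensor_comm, hw, map_sub, hz, lTensor_d_d]
    exact sub_zero (inc 1 ⊗ₜ[R] f)
  have h0 : (1 : A) ⊗ₜ[R] ε f = 0 := by
    rw [← LinearMap.lTensor_tmul, ← hd]
    exact (lTensor_exact A h.exact h.surj).apply_apply_eq_zero w
  have h1 := congrArg (TensorProduct.quotTensorEquivQuotSMul M (Ideal.ofList rs)) h0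
  rwa [map_zero, TensorProduct.quotTensorEquivQuotSMul_mk_one_tmul,
    Submodule.Quotient.mk_eq_zero] at h1

end FreeSeq

namespace FreeSeq

section Cons

variable {R : Type} [CommRing R] (F : FreeSeq R)

/-- Extend a sequence of free modules by one map on the right. -/
def cons {m : ℕ} (g : F.X 0 →ₗ[R] (Fin m → R)) (hg : Function.Exact (F.d 0) g) : FreeSeq R where
  k
    | 0 => m
    | n + 1 => F.k n
  d
    | 0 => g
    | n + 1 => F.d n
  exact
    | 0 => hg
    | n + 1 => F.exact n

variable {F} {N M : Type} [AddCommGroup N] [AddCommGroup M] [Module R N] [Module R M]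
  {δ : F.X 0 →ₗ[R] N} {m : ℕ} {κ : N →ₗ[R] (Fin m → R)} {π : (Fin m → R) →ₗ[R] M}

lemma Resolves.exact_comp (hF : F.Resolves δ) (hκ : Function.Injective κ) :
    Function.Exact (F.d 0) (κ ∘ₗ δ) := fun x => by
  rw [LinearMap.comp_apply, map_eq_zero_iff κ hκ]
  exact hF.exact x

lemma Resolves.cons (hF : F.Resolves δ) (hκ : Function.Injective κ)
    (hπ : Function.Surjective π) (hκπ : Function.Exact κ π) :
    (F.cons (κ ∘ₗ δ) (hF.exact_comp hκ)).Resolves π where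
  surj := hπ
  exact x := (hκπ x).trans ⟨fun ⟨y, hy⟩ => by
    obtain ⟨z, rfl⟩ := hF.surj y
    exact ⟨z, hy⟩, fun ⟨z, hz⟩ => ⟨δ z, hz⟩⟩

lemma Resolves.extVanish_cons_zero (hF : F.Resolves δ) (hκ : Function.Injective κ)
    (h : ∀ u : N →ₗ[R] R, ∃ w : (Fin m → R) →ₗ[R] R, w ∘ₗ κ = u) :
    (F.cons (κ ∘ₗ δ) (hF.exact_comp hκ)).ExtVanish R 0 := by
  intro u
  refine ⟨fun hu => ?_, ?_⟩
  · obtain ⟨v, hv⟩ := hF.exists_desc u (LinearMap.congr_fun hu)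
    obtain ⟨w, rfl⟩ := h v
    exact ⟨w, LinearMap.ext hv⟩
  · rintro ⟨w, rfl⟩
    exact lcomp_d_d _ R 0 w

end Cons

variable {R : Type} [CommRing R] {F : FreeSeq R} {M : Type} [AddCommGroup M] [Module R M]
  {ε : F.X 0 →ₗ[R] M}

lemma StronglyResolves.coker (h : F.StronglyResolves ε) {m : ℕ} {f : M →ₗ[R] (Fin m → R)}
    (hf : Function.Injective f)
    (hdual : ∀ u : M →ₗ[R] R, ∃ w : (Fin m → R) →ₗ[R] R, w ∘ₗ f = u) :
    (F.cons (f ∘ₗ ε) (h.exact_comp hf)).StronglyResolves (LinearMap.range f).mkQ where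
  toResolves := h.toResolves.cons hf (Submodule.mkQ_surjective _) (LinearMap.exact_map_mkQ_range f)
  extVanish
    | 0 => h.extVanish_cons_zero hf hdual
    | i + 1 => h.extVanish i

variable [IsLocalRing R] {rs : List R} [IsNoetherianRing R] [Module.Finite R M]

lemma StronglyResolves.injective (h : F.StronglyResolves ε) (hdep : PropDep R)
    (hrs : IsParameterSequence rs) {m : ℕ} {f : M →ₗ[R] (Fin m → R)}
    (hdual : ∀ u : M →ₗ[R] R, ∃ w : (Fin m → R) →ₗ[R] R, w ∘ₗ f = u) : Function.Injective f := by
  refine injective_of_injective_mod (rs := rs) hrs.mem ?_ f fun x hx =>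
    h.mem_smul_top hdep hrs fun u => ?_
  · exact (LinearEquiv.isWeaklyRegular_congr (TensorProduct.rid R (Fin m → R)) rs).1
      hrs.regular.toIsWeaklyRegular.isWeaklyRegular_lTensor
  let e := Submodule.quotEquivOfEq (Ideal.ofList rs • (⊤ : Submodule R R)) (Ideal.ofList rs)
    (by simp)
  obtain ⟨v, hv⟩ := h.exists_lift_quotient hrs.regular.toIsWeaklyRegular h.extVanish
    (e.symm.toLinearMap ∘ₗ u)
  obtain ⟨w, rfl⟩ := hdual v
  have hw : w (f x) ∈ Ideal.ofList rs • (⊤ : Submodule R R) := by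
    have := Submodule.mem_map_of_mem (f := w) hx
    rw [Submodule.map_smul''] at this
    exact Submodule.smul_mono le_rfl le_top this
  rw [← e.symm.map_eq_zero_iff]
  exact (LinearMap.congr_fun hv x).symm.trans ((Submodule.Quotient.mk_eq_zero _).2 hw)

variable (R M) in
omit [IsLocalRing R] in
lemma exists_dual_surjective : ∃ (m : ℕ) (f : M →ₗ[R] (Fin m → R)),
    ∀ u : M →ₗ[R] R, ∃ w : (Fin m → R) →ₗ[R] R, w ∘ₗ f = u := by
  obtain ⟨m, h, hh⟩ := Module.Finite.exists_fin (R := R) (M := M →ₗ[R] R)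
  refine ⟨m, LinearMap.pi h, fun u => ?_⟩
  have : ⊤ ≤ LinearMap.range ((LinearMap.pi h).lcomp R R) := by
    rw [← hh, Submodule.span_le]
    rintro _ ⟨i, rfl⟩
    exact ⟨LinearMap.proj i, rfl⟩
  exact this (x := u) trivial

lemma StronglyResolves.eq_zero (h : F.StronglyResolves ε) (hdep : PropDep R)
    (hrs : IsParameterSequence rs) {x : M} (hx : ∀ u : M →ₗ[R] R, u x = 0) : x = 0 := by
  obtain ⟨m, f, hf⟩ := exists_dual_surjective R M
  refine h.injective hdep hrs hf ((funext fun i => ?_ : f x = 0).trans f.map_zero.symm)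
  exact hx (LinearMap.proj i ∘ₗ f)

lemma StronglyResolves.bijective_eval (h : F.StronglyResolves ε) (hdep : PropDep R)
    (hrs : IsParameterSequence rs) : Function.Bijective (Module.Dual.eval R M) := by
  refine ⟨(injective_iff_map_eq_zero _).2 fun x hx =>
    h.eq_zero hdep hrs (LinearMap.congr_fun hx), fun Φ => ?_⟩
  obtain ⟨m, f, hf⟩ := exists_dual_surjective R M
  have hC := h.coker (h.injective hdep hrs hf) hf
  obtain ⟨g, hg⟩ := (Module.evalEquiv R (Fin m → R)).surjective (Φ ∘ₗ f.dualMap)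
  replace hg (w : (Fin m → R) →ₗ[R] R) : w g = Φ (w ∘ₗ f) := LinearMap.congr_fun hg w
  have h0 : (LinearMap.range f).mkQ g = 0 := hC.eq_zero hdep hrs fun u => by
    refine (hg (u ∘ₗ (LinearMap.range f).mkQ)).trans ?_
    rw [LinearMap.comp_assoc, LinearMap.range_mkQ_comp, LinearMap.comp_zero, map_zero]
  obtain ⟨x, hx⟩ := (Submodule.Quotient.mk_eq_zero _).1 h0
  refine ⟨x, LinearMap.ext fun u => ?_⟩
  obtain ⟨w, rfl⟩ := hf u
  rw [← hg, ← hx]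
  rfl

omit [IsLocalRing R] [IsNoetherianRing R] [Module.Finite R M] in
lemma _root_.LinearMap.exact_dualMap_mkQ_range {N : Type} [AddCommGroup N] [Module R N]
    (f : M →ₗ[R] N) : Function.Exact (LinearMap.range f).mkQ.dualMap f.dualMap := by
  refine fun w => ⟨fun hw => ?_, ?_⟩
  · have h := LinearMap.range_le_ker_iff.2 hw
    exact ⟨(LinearMap.range f).liftQ w h, (LinearMap.range f).liftQ_mkQ w h⟩
  · rintro ⟨u, rfl⟩
    change (u ∘ₗ (LinearMap.range f).mkQ) ∘ₗ f = 0
    rw [LinearMap.comp_assoc, LinearMap.range_mkQ_comp, LinearMap.comp_zero]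

omit [IsLocalRing R] [IsNoetherianRing R] [Module.Finite R M] in
lemma injective_dual_mkQ_range {m : ℕ} (f : M →ₗ[R] (Fin m → R)) : Function.Injective
    ((dotProductEquiv R (Fin m)).symm.toLinearMap ∘ₗ (LinearMap.range f).mkQ.dualMap) :=
  (dotProductEquiv R (Fin m)).symm.injective.comp
    (LinearMap.dualMap_injective_of_surjective (Submodule.mkQ_surjective _))

omit [IsLocalRing R] [IsNoetherianRing R] [Module.Finite R M] in
lemma Resolves.cons_dual {m : ℕ} {f : M →ₗ[R] (Fin m → R)} {P : FreeSeq R}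
    {δ : P.X 0 →ₗ[R] Module.Dual R ((Fin m → R) ⧸ LinearMap.range f)} (hP : P.Resolves δ)
    (hf : ∀ u : M →ₗ[R] R, ∃ w : (Fin m → R) →ₗ[R] R, w ∘ₗ f = u) :
    (P.cons _ (hP.exact_comp (injective_dual_mkQ_range f))).Resolves
      (f.dualMap ∘ₗ (dotProductEquiv R (Fin m)).toLinearMap) :=
  hP.cons (injective_dual_mkQ_range f)
    (.comp (g := f.dualMap) hf (dotProductEquiv R (Fin m)).surjective) fun x =>
    (f.exact_dualMap_mkQ_range (dotProductEquiv R (Fin m) x)).trans <|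
      exists_congr fun _ => (LinearEquiv.symm_apply_eq _).symm

lemma StronglyResolves.subsingleton_extGroup_dual (h : F.StronglyResolves ε) (hdep : PropDep R)
    (hrs : IsParameterSequence rs) (i : ℕ) :
    Subsingleton (ExtGroup R (i + 1) (ModuleCat.of R (Module.Dual R M)) (ModuleCat.of R R)) := by
  induction i using Nat.strong_induction_on generalizing M F with | _ i ih
  obtain ⟨m, f, hf⟩ := exists_dual_surjective R M
  have hC := h.coker (h.injective hdep hrs hf) hf
  obtain ⟨P, δ, hP⟩ :=
    exists_resolves (R := R) (Module.Dual R ((Fin m → R) ⧸ LinearMap.range f))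
  refine ((hP.cons_dual hf).subsingleton_extGroup_iff R i).2 ?_
  cases i with
  | zero =>
    refine hP.extVanish_cons_zero (injective_dual_mkQ_range f) fun u => ?_
    obtain ⟨c, rfl⟩ := (hC.bijective_eval hdep hrs).2 u
    obtain ⟨g, rfl⟩ := Submodule.mkQ_surjective _ c
    refine ⟨Module.Dual.eval R _ g ∘ₗ (dotProductEquiv R (Fin m)).toLinearMap,
      LinearMap.ext fun u => ?_⟩
    exact LinearMap.congr_fun ((dotProductEquiv R (Fin m)).apply_symm_apply _) g
  | succ i => exact (hP.subsingleton_extGroup_iff R i).1 (ih i i.lt_succ_self hC)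

end FreeSeq

/-- a Cohen–Macaulay local ring of positive dimension satisfying
the depth formula satisfies (tr). -/
theorem stmt15 (R : Type) [CommRing R] [IsLocalRing R] [IsNoetherianRing R]
    (hCM : IsCohenMacaulayLocalRing R) (hdim : 0 < ringKrullDim R)
    (h : PropDep R) : PropTR R := by
  intro M _ _ hfin hExt
  obtain ⟨rs, h₁, h₂, h₃, h₄, h₅⟩ := exists_isRegular_of_isCohenMacaulay R hCM hdim
  have hrs : IsParameterSequence rs := ⟨h₁, h₂, h₃, h₄, h₅⟩
  obtain ⟨F, ε, hF⟩ := FreeSeq.exists_resolves (R := R) M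
  have hs : F.StronglyResolves ε :=
    ⟨hF, fun i => (hF.subsingleton_extGroup_iff R i).1 (hExt (i + 1) i.succ_pos)⟩
  refine ⟨hfin, hs.bijective_eval h hrs, hExt, fun i hi => ?_⟩
  obtain ⟨j, rfl⟩ := Nat.exists_eq_succ_of_ne_zero hi.ne'
  exact hs.subsingleton_extGroup_dual h hrs j
end
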